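/- arXiv:1704.03625 — 3 statements merged into one kernel-verified Lean document; each statement's English description precedes it below -/
import Mathlib

section
/- Let K = {0}, so Ω = ℝ^d \ {0}, d_Γ(x) = |x| and d_H = 0. Let p ∈ [1,∞) and δ, δ' ≥ 0 with d + min(δ,δ') − p > 0. Then the optimal Hardy constant equals μ_p(Ω) = ((d + min(δ,δ') − p)/p)^p; that is, the infimum over nonzero φ ∈ C_c^1(Ω) of (∫_Ω c_Ω |∇φ|^p)/(∫_Ω c_Ω |x|^{−p} |φ|^p) equals ((d + min(δ,δ') − p)/p)^p. -/
open MeasureTheory Set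
noncomputable section

lemma aux_div {d : ℕ} (f : EuclideanSpace ℝ (Fin d) → ℝ) (hf : ContDiff ℝ 1 f)
    (hc : HasCompactSupport f) :
    ∫ x, fderiv ℝ f x x = - (d : ℝ) * ∫ x, f x := by
  have hcf : Continuous (fderiv ℝ f) := hf.continuous_fderiv one_ne_zero
  have hsum : ∀ x : EuclideanSpace ℝ (Fin d), fderiv ℝ f x x
      = ∑ i, x i * fderiv ℝ f x (EuclideanSpace.single i 1) := by
    intro x
    generalize fderiv ℝ f x = L
    conv_lhs => rw [← (EuclideanSpace.basisFun (Fin d) ℝ).sum_repr x]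
    simp only [map_sum, map_smul, smul_eq_mul, EuclideanSpace.basisFun_apply, EuclideanSpace.basisFun_repr]
  have hco : ∀ i : Fin d, Continuous (fun x : EuclideanSpace ℝ (Fin d) => x i) := by
    intro i; fun_prop
  have hint : ∀ i : Fin d, Integrable (fun x : EuclideanSpace ℝ (Fin d) =>
      x i * fderiv ℝ f x (EuclideanSpace.single i 1)) := by
    intro i
    refine Continuous.integrable_of_hasCompactSupport (by fun_prop) ?_
    exact (HasCompactSupport.fderiv_apply ℝ hc (EuclideanSpace.single i 1)).mul_left
  have hfd : ∀ (i : Fin d) (x : EuclideanSpace ℝ (Fin d)),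
      fderiv ℝ (fun x : EuclideanSpace ℝ (Fin d) => x i) x (EuclideanSpace.single i 1) = 1 := by
    intro i x
    have : (fun x : EuclideanSpace ℝ (Fin d) => x i) = (EuclideanSpace.proj i : _ →L[ℝ] ℝ) := rfl
    rw [this, ContinuousLinearMap.fderiv]
    simp
  simp_rw [hsum]
  rw [integral_finsetSum _ (fun i _ => hint i)]
  have : ∀ i : Fin d, ∫ x : EuclideanSpace ℝ (Fin d),
      x i * fderiv ℝ f x (EuclideanSpace.single i 1) = - ∫ x, f x := by
    intro i
    rw [integral_mul_fderiv_eq_neg_fderiv_mul_of_integrable]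
    · simp only [hfd, one_mul]
    · simp only [hfd, one_mul]
      exact hf.continuous.integrable_of_hasCompactSupport hc
    · exact hint i
    · exact Continuous.integrable_of_hasCompactSupport ((hco i).mul hf.continuous) hc.mul_left
    · intro x _; fun_prop
    · intro x _; exact (hf.differentiable one_ne_zero) x
  simp [this]

lemma aux_young {p s b : ℝ} (hp : 1 ≤ p) (hs : 0 ≤ s) (hb : 0 ≤ b) :
    p * (s ^ (p-1) * b) ≤ (p-1) * s ^ p + b ^ p := by
  rcases hs.eq_or_lt with rfl | hs
  · rcases hp.eq_or_lt with rfl | hp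
    · simp
    · rw [Real.zero_rpow (by linarith), Real.zero_rpow (by linarith)]
      have := Real.rpow_nonneg hb p
      linarith
  · have h := one_add_mul_self_le_rpow_one_add (s := b / s - 1)
      (by have := div_nonneg hb hs.le; linarith) hp
    have h1 : (1 + (b/s - 1)) ^ p = b ^ p / s ^ p := by
      rw [add_sub_cancel, Real.div_rpow hb hs.le]
    rw [h1, le_div_iff₀ (by positivity)] at h
    have h2 : s ^ p = s ^ (p-1) * s := by
      rw [← Real.rpow_add_one hs.ne']; simp
    have h3 : (1 + p * (b / s - 1)) * s ^ p = s ^ p + p * (s ^ (p-1) * b) - p * s ^ p := by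
      rw [h2]; field_simp; ring
    linarith

def VV (p δ δ' r : ℝ) : ℝ := r ^ δ * (1 + r) ^ (δ' - δ) * r ^ (-p)

lemma VV_nonneg {p δ δ' r : ℝ} (hr : 0 ≤ r) : 0 ≤ VV p δ δ' r := by unfold VV; positivity
lemma VV_pos {p δ δ' r : ℝ} (hr : 0 < r) : 0 < VV p δ δ' r := by unfold VV; positivity

lemma VV_deriv {p δ δ' r : ℝ} (hr : 0 < r) :
    HasDerivAt (VV p δ δ') ((δ + (δ' - δ) * (r / (1 + r)) - p) * VV p δ δ' r / r) r := by
  have h1 := Real.hasDerivAt_rpow_const (x := r) (p := δ) (Or.inl hr.ne')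
  have h3 := Real.hasDerivAt_rpow_const (x := r) (p := -p) (Or.inl hr.ne')
  have h2 := ((hasDerivAt_id r).const_add 1).rpow_const (p := δ' - δ) (Or.inl (by simp; linarith))
  have := (h1.mul h2).mul h3
  refine this.congr_deriv ?_
  simp only [id, VV, Pi.mul_apply]
  rw [Real.rpow_sub_one hr.ne', Real.rpow_sub_one hr.ne', Real.rpow_sub_one (by linarith)]
  have : 1 + r ≠ 0 := by linarith
  field_simp
  ring

lemma VV_contDiffAt {p δ δ' r : ℝ} (hr : 0 < r) : ContDiffAt ℝ 1 (VV p δ δ') r := by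
  unfold VV
  refine ContDiffAt.mul (ContDiffAt.mul ?_ ?_) ?_
  · exact contDiffAt_id.rpow_const_of_ne hr.ne'
  · exact (contDiffAt_const.add contDiffAt_id).rpow_const_of_ne (by simp; linarith)
  · exact contDiffAt_id.rpow_const_of_ne hr.ne'

lemma VV_fderiv {d : ℕ} {p δ δ' : ℝ} {x : EuclideanSpace ℝ (Fin d)} (hx : x ≠ 0) :
    HasFDerivAt (fun x : EuclideanSpace ℝ (Fin d) => VV p δ δ' ‖x‖)
      (((δ + (δ' - δ) * (‖x‖ / (1 + ‖x‖)) - p) * VV p δ δ' ‖x‖ / ‖x‖) • fderiv ℝ norm x) x := by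
  have h := (contDiffAt_norm (n := 1) ℝ hx).differentiableAt one_ne_zero
  exact (VV_deriv (norm_pos_iff.2 hx)).comp_hasFDerivAt x h.hasFDerivAt

lemma aux_eps {p ε : ℝ} (hε : 0 < ε) (s : ℝ) :
    HasDerivAt (fun s : ℝ => (s^2+ε^2) ^ (p/2) - (ε^2) ^ (p/2)) (p * s * (s^2+ε^2) ^ (p/2-1)) s := by
  have h : HasDerivAt (fun s : ℝ => s^2+ε^2) (2 * s) s := by
    simpa using (hasDerivAt_pow 2 s).add_const (ε^2)
  refine ((h.rpow_const (p := p/2) (Or.inl (by positivity))).sub_const _).congr_deriv ?_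
  ring

lemma aux_eps_le {p ε : ℝ} (hp : 1 ≤ p) (hε : 0 < ε) (s : ℝ) :
    |p * s * (s^2+ε^2) ^ (p/2-1)| ≤ p * (s^2+ε^2) ^ ((p-1)/2) := by
  have h0 : 0 < s^2+ε^2 := by positivity
  rw [abs_mul, abs_mul, abs_of_nonneg (by linarith : 0 ≤ p), abs_of_pos (Real.rpow_pos_of_pos h0 _), mul_assoc]
  refine mul_le_mul_of_nonneg_left ?_ (by linarith)
  have : (s^2+ε^2) ^ ((p-1)/2) = (s^2+ε^2) ^ (1/2:ℝ) * (s^2+ε^2) ^ (p/2-1) := by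
    rw [← Real.rpow_add h0]; ring_nf
  rw [this]
  refine mul_le_mul_of_nonneg_right ?_ (by positivity)
  rw [← Real.sqrt_eq_rpow]
  apply Real.abs_le_sqrt
  nlinarith [sq_nonneg ε]

lemma cut {d : ℕ} {p δ δ' : ℝ} (K : Set (EuclideanSpace ℝ (Fin d))) (hK : IsClosed K)
    (h0 : K ⊆ {0}ᶜ) : ∃ V : EuclideanSpace ℝ (Fin d) → ℝ, Continuous V ∧ (∀ x, 0 ≤ V x) ∧
      ∀ x ∈ K, V x = VV p δ δ' ‖x‖ := by
  have : Kᶜ ∈ nhds (0 : EuclideanSpace ℝ (Fin d)) := hK.isOpen_compl.mem_nhds (fun h => h0 h rfl)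
  obtain ⟨ρ, hρ, hb⟩ := Metric.mem_nhds_iff.1 this
  refine ⟨fun x => VV p δ δ' (max ‖x‖ ρ), ?_, ?_, ?_⟩
  · rw [continuous_iff_continuousAt]
    intro x
    have h1 : ContinuousAt (VV p δ δ') (max ‖x‖ ρ) :=
      (VV_contDiffAt (lt_max_of_lt_right hρ)).continuousAt
    exact ContinuousAt.comp (g := VV p δ δ') h1 (by fun_prop)
  · intro x; exact VV_nonneg (le_max_of_le_right hρ.le)
  · intro x hx
    have : ρ ≤ ‖x‖ := by
      by_contra hc
      exact hb (by simpa using hc) hx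
    simp [this]

lemma contDiff_of_ts {E : Type*} [NormedAddCommGroup E] [NormedSpace ℝ E] {f : E → ℝ}
    (h : ∀ x ∈ tsupport f, ContDiffAt ℝ 1 f x) : ContDiff ℝ 1 f := by
  rw [contDiff_iff_contDiffAt]
  intro x
  by_cases hx : x ∈ tsupport f
  · exact h x hx
  · exact (contDiffAt_const (c := (0:ℝ))).congr_of_eventuallyEq (notMem_tsupport_iff_eventuallyEq.1 hx)

lemma fderiv_zero_of {E : Type*} [NormedAddCommGroup E] [NormedSpace ℝ E] {φ : E → ℝ} {x : E}
    (hx : x ∉ tsupport φ) : fderiv ℝ φ x = 0 := by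
  by_contra h
  exact hx (tsupport_fderiv_subset ℝ (subset_tsupport _ h))

lemma lower_eps {d : ℕ} {p δ δ' ε : ℝ} (hp : 1 ≤ p) (hε : 0 < ε)
    {φ : EuclideanSpace ℝ (Fin d) → ℝ} (h1 : ContDiff ℝ 1 φ) (h2 : HasCompactSupport φ)
    (h3 : tsupport φ ⊆ ({0}ᶜ : Set (EuclideanSpace ℝ (Fin d))))
    {V : EuclideanSpace ℝ (Fin d) → ℝ} (hV : Continuous V) (hV0 : ∀ x, 0 ≤ V x)
    (hVV : ∀ x ∈ tsupport φ, V x = VV p δ δ' ‖x‖) :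
    (d + min δ δ' - p) * ∫ x, V x * ((φ x ^ 2 + ε ^ 2) ^ (p/2) - (ε^2) ^ (p/2)) ≤
      p * ∫ x, V x * ‖x‖ * ‖fderiv ℝ φ x‖ * (φ x ^ 2 + ε ^ 2) ^ ((p-1)/2) := by
  set h : EuclideanSpace ℝ (Fin d) → ℝ := fun x => (φ x ^ 2 + ε ^ 2) ^ (p/2) - (ε^2) ^ (p/2) with hh
  set f : EuclideanSpace ℝ (Fin d) → ℝ := fun x => V x * h x with hf
  have hφ0 : ∀ x, x ∉ tsupport φ → φ x = 0 := fun x hx => image_eq_zero_of_notMem_tsupport hx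
  have hsub : Function.support f ⊆ Function.support φ := by
    intro x hx hx0
    apply hx
    have : φ x = 0 := hx0
    simp [hf, hh, this]
  have hts : tsupport f ⊆ tsupport φ := closure_mono hsub
  have hfc : HasCompactSupport f := h2.mono hsub
  have hfeq : f = fun x => VV p δ δ' ‖x‖ * h x := by
    ext x
    by_cases hx : x ∈ tsupport φ
    · simp [hf, hVV x hx]
    · simp [hf, hh, hφ0 x hx]
  have hhn : ∀ x, 0 ≤ h x := by
    intro x
    simp only [hh, sub_nonneg]
    exact Real.rpow_le_rpow (by positivity) (by nlinarith [sq_nonneg (φ x)]) (by linarith)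
  have hhd : ∀ x, HasFDerivAt h ((p * φ x * (φ x^2+ε^2) ^ (p/2-1)) • fderiv ℝ φ x) x := by
    intro x
    exact (aux_eps hε (φ x)).comp_hasFDerivAt x ((h1.differentiable one_ne_zero) x).hasFDerivAt
  have hhC : ContDiff ℝ 1 h := by
    refine ContDiff.sub (ContDiff.rpow_const_of_ne (by fun_prop) ?_) contDiff_const
    intro x; positivity
  have hfC : ContDiff ℝ 1 f := by
    apply contDiff_of_ts
    intro x hx
    have hx0 : x ≠ 0 := h3 (hts hx)
    rw [hfeq]
    refine ContDiffAt.mul ?_ hhC.contDiffAt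
    exact ContDiffAt.comp (g := VV p δ δ') x (VV_contDiffAt (norm_pos_iff.2 hx0)) (contDiffAt_norm ℝ hx0)
  have hdiv := aux_div f hfC hfc
  have hle : ∀ x, - fderiv ℝ f x x ≤ (p - min δ δ') * f x +
      p * (V x * ‖x‖ * ‖fderiv ℝ φ x‖ * (φ x ^ 2 + ε ^ 2) ^ ((p-1)/2)) := by
    intro x
    by_cases hx : x ∈ tsupport φ
    · have hx0 : x ≠ 0 := h3 hx
      have hr : 0 < ‖x‖ := norm_pos_iff.2 hx0
      have hfd := ((VV_fderiv (p := p) (δ := δ) (δ' := δ') hx0).mul (hhd x)).congr_of_eventuallyEq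
        (f₁ := f) (Filter.Eventually.of_forall (fun y => congrFun hfeq y))
      rw [hfd.fderiv]
      have hn := ((contDiffAt_norm (n := 1) ℝ hx0).differentiableAt one_ne_zero).fderiv_norm_self
      simp only [add_apply, smul_apply, smul_eq_mul]
      rw [hn]
      simp only [hf]
      rw [hVV x hx]
      have hv := VV_nonneg (p := p) (δ := δ) (δ' := δ') hr.le
      set v := VV p δ δ' ‖x‖
      have e1 : (δ + (δ' - δ) * (‖x‖ / (1 + ‖x‖)) - p) * v / ‖x‖ * ‖x‖ =
        (δ + (δ' - δ) * (‖x‖ / (1 + ‖x‖)) - p) * v := by field_simp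
      have e2 : min δ δ' ≤ δ + (δ' - δ) * (‖x‖ / (1 + ‖x‖)) := by
        have t0 : 0 ≤ ‖x‖ / (1 + ‖x‖) := by positivity
        have t1 : ‖x‖ / (1 + ‖x‖) ≤ 1 := by rw [div_le_one (by positivity)]; linarith
        generalize ‖x‖ / (1 + ‖x‖) = t at *
        rcases le_total δ δ' with hl | hl
        · rw [min_eq_left hl]; nlinarith
        · rw [min_eq_right hl]; nlinarith
      have e3 : -(p * φ x * (φ x^2+ε^2) ^ (p/2-1) * fderiv ℝ φ x x) ≤
          p * (φ x^2+ε^2) ^ ((p-1)/2) * (‖fderiv ℝ φ x‖ * ‖x‖) := by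
        refine (neg_le_abs _).trans ?_
        rw [abs_mul]
        refine mul_le_mul (aux_eps_le hp hε _) ((fderiv ℝ φ x).le_opNorm x) (abs_nonneg _) ?_
        have : 0 ≤ p := by linarith
        positivity
      have e4 := mul_le_mul_of_nonneg_left e3 hv
      have e5 := mul_nonneg (mul_nonneg hv (hhn x)) (sub_nonneg.2 e2)
      have e6 : h x * ((δ + (δ' - δ) * (‖x‖ / (1 + ‖x‖)) - p) * v / ‖x‖ * ‖x‖) =
        h x * ((δ + (δ' - δ) * (‖x‖ / (1 + ‖x‖)) - p) * v) := by rw [e1]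
      rw [e6]
      nlinarith
    · have a1 : fderiv ℝ f x = 0 := fderiv_zero_of (fun hc => hx (hts hc))
      have a2 : fderiv ℝ φ x = 0 := fderiv_zero_of hx
      have a3 : f x = 0 := by simp [hf, hh, hφ0 x hx]
      simp [a1, a2, a3]
  have hcf : Continuous (fderiv ℝ f) := hfC.continuous_fderiv one_ne_zero
  have hcφ : Continuous (fderiv ℝ φ) := h1.continuous_fderiv one_ne_zero
  have i1 : Integrable (fun x => fderiv ℝ f x x) := by
    refine Continuous.integrable_of_hasCompactSupport (by fun_prop) ?_
    refine (hfc.fderiv ℝ).mono ?_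
    intro x hx h0
    apply hx
    simp [show fderiv ℝ f x = 0 from h0]
  have i2 : Integrable f := hfC.continuous.integrable_of_hasCompactSupport hfc
  have i3 : Integrable (fun x => V x * ‖x‖ * ‖fderiv ℝ φ x‖ * (φ x ^ 2 + ε ^ 2) ^ ((p-1)/2)) := by
    refine Continuous.integrable_of_hasCompactSupport ?_ ?_
    · refine Continuous.mul (by fun_prop) (Continuous.rpow_const ?_ ?_)
      · have := h1.continuous; fun_prop
      · intro x; right; linarith
    · refine (h2.fderiv ℝ).mono ?_
      intro x hx h0
      apply hx
      simp [show fderiv ℝ φ x = 0 from h0]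
  have := integral_mono i1.neg ((i2.const_mul (p - min δ δ')).add (i3.const_mul p)) hle
  simp only [Pi.neg_apply, Pi.add_apply] at this
  rw [integral_neg, integral_add (i2.const_mul _) (i3.const_mul _), integral_const_mul, integral_const_mul, hdiv] at this
  linarith

lemma lower_bd {d : ℕ} {p δ δ' : ℝ} (hp : 1 ≤ p) (hcond : 0 < (d : ℝ) + min δ δ' - p)
    {φ : EuclideanSpace ℝ (Fin d) → ℝ} (h1 : ContDiff ℝ 1 φ) (h2 : HasCompactSupport φ)
    (h3 : tsupport φ ⊆ ({0}ᶜ : Set (EuclideanSpace ℝ (Fin d)))) (h4 : φ ≠ 0) :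
    (((d : ℝ) + min δ δ' - p) / p) ^ p ≤ (∫ x in ({0}ᶜ : Set (EuclideanSpace ℝ (Fin d))),
              (‖x‖ ^ δ * (1 + ‖x‖) ^ (δ' - δ)) * ‖gradient φ x‖ ^ p) /
            (∫ x in ({0}ᶜ : Set (EuclideanSpace ℝ (Fin d))),
              (‖x‖ ^ δ * (1 + ‖x‖) ^ (δ' - δ)) * ‖x‖ ^ (-p) * |φ x| ^ p) := by
  have hp0 : 0 < p := by linarith
  obtain ⟨V, hV, hV0, hVV⟩ := cut (p := p) (δ := δ) (δ' := δ') (tsupport φ) (isClosed_tsupport φ) h3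
  have hφ0 : ∀ x, x ∉ tsupport φ → φ x = 0 := fun x hx => image_eq_zero_of_notMem_tsupport hx
  have hg : ∀ x, ‖gradient φ x‖ = ‖fderiv ℝ φ x‖ := by
    intro x; simp [gradient]
  have hK : IsCompact (tsupport φ) := h2
  have hcφ : Continuous (fderiv ℝ φ) := h1.continuous_fderiv one_ne_zero
  have hc1 := h1.continuous
  have hden : (∫ x in ({0}ᶜ : Set (EuclideanSpace ℝ (Fin d))),
              (‖x‖ ^ δ * (1 + ‖x‖) ^ (δ' - δ)) * ‖x‖ ^ (-p) * |φ x| ^ p) = ∫ x, V x * |φ x| ^ p := by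
    rw [setIntegral_eq_integral_of_forall_compl_eq_zero]
    · congr 1; ext x
      by_cases hx : x ∈ tsupport φ
      · rw [hVV x hx]; rfl
      · simp [hφ0 x hx, Real.zero_rpow hp0.ne']
    · intro x hx
      have : x ∉ tsupport φ := fun h => hx (h3 h)
      simp [hφ0 x this, Real.zero_rpow hp0.ne']
  have hnum : (∫ x in ({0}ᶜ : Set (EuclideanSpace ℝ (Fin d))),
              (‖x‖ ^ δ * (1 + ‖x‖) ^ (δ' - δ)) * ‖gradient φ x‖ ^ p)
              = ∫ x, V x * (‖x‖ * ‖fderiv ℝ φ x‖) ^ p := by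
    rw [setIntegral_eq_integral_of_forall_compl_eq_zero]
    · congr 1; ext x
      rw [hg]
      by_cases hx : x ∈ tsupport φ
      · rw [hVV x hx, VV, Real.mul_rpow (norm_nonneg _) (norm_nonneg _),
          Real.rpow_neg (norm_nonneg _)]
        have : 0 < ‖x‖ ^ p := Real.rpow_pos_of_pos (norm_pos_iff.2 (h3 hx)) _
        field_simp
      · simp [fderiv_zero_of hx, Real.zero_rpow hp0.ne']
    · intro x hx
      rw [hg]
      have : x ∉ tsupport φ := fun h => hx (h3 h)
      simp [fderiv_zero_of this, Real.zero_rpow hp0.ne']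
  have cA : Continuous (fun x => V x * |φ x| ^ p) :=
    hV.mul (hc1.abs.rpow_const (fun _ => Or.inr hp0.le))
  have sA : HasCompactSupport (fun x => V x * |φ x| ^ p) := by
    refine h2.mono ?_
    intro x hx h0
    exact hx (by simp [show φ x = 0 from h0, Real.zero_rpow hp0.ne'])
  have iA := cA.integrable_of_hasCompactSupport (μ := volume) sA
  have iB : Integrable (fun x => V x * (‖x‖ * ‖fderiv ℝ φ x‖) ^ p) := by
    refine Continuous.integrable_of_hasCompactSupport ?_ ?_
    · refine hV.mul (Continuous.rpow_const (by fun_prop) (fun _ => Or.inr hp0.le))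
    · refine (h2.fderiv ℝ).mono ?_
      intro x hx h0
      exact hx (by simp [show fderiv ℝ φ x = 0 from h0, Real.zero_rpow hp0.ne'])
  have iC : Integrable (fun x => V x * ‖x‖ * ‖fderiv ℝ φ x‖ * |φ x| ^ (p-1)) := by
    refine Continuous.integrable_of_hasCompactSupport ?_ ?_
    · refine Continuous.mul (by fun_prop) (Continuous.rpow_const (by fun_prop) (fun _ => Or.inr (by linarith)))
    · refine (h2.fderiv ℝ).mono ?_
      intro x hx h0
      exact hx (by simp [show fderiv ℝ φ x = 0 from h0])
  have hApos : 0 < ∫ x, V x * |φ x| ^ p := by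
    obtain ⟨x, hx⟩ := Function.ne_iff.1 h4
    have hx' : φ x ≠ 0 := hx
    have hxt : x ∈ tsupport φ := subset_tsupport _ hx
    refine Continuous.integral_pos_of_hasCompactSupport_nonneg_nonzero (x := x) cA sA ?_ ?_
    · intro y; exact mul_nonneg (hV0 y) (by positivity)
    · have := VV_pos (p := p) (δ := δ) (δ' := δ') (norm_pos_iff.2 (h3 hxt))
      rw [hVV x hxt]
      have : 0 < |φ x| := abs_pos.2 hx'
      positivity
  -- limit
  have hlim : (d + min δ δ' - p) * ∫ x, V x * |φ x| ^ p ≤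
      p * ∫ x, V x * ‖x‖ * ‖fderiv ℝ φ x‖ * |φ x| ^ (p-1) := by
    have c1 : Continuous (fun ε : ℝ => ∫ x in tsupport φ,
        V x * ((φ x ^ 2 + ε ^ 2) ^ (p/2) - (ε^2) ^ (p/2))) := by
      apply continuous_parametric_integral_of_continuous _ hK
      refine Continuous.mul (by fun_prop) (Continuous.sub ?_ ?_)
      · exact Continuous.rpow_const (by fun_prop) (fun _ => Or.inr (by linarith))
      · exact Continuous.rpow_const (by fun_prop) (fun _ => Or.inr (by linarith))
    have c2 : Continuous (fun ε : ℝ => ∫ x in tsupport φ,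
        V x * ‖x‖ * ‖fderiv ℝ φ x‖ * (φ x ^ 2 + ε ^ 2) ^ ((p-1)/2)) := by
      apply continuous_parametric_integral_of_continuous _ hK
      refine Continuous.mul (by fun_prop) ?_
      exact Continuous.rpow_const (by fun_prop) (fun _ => Or.inr (by linarith))
    have r1 : ∀ ε : ℝ, ∫ x in tsupport φ,
        V x * ((φ x ^ 2 + ε ^ 2) ^ (p/2) - (ε^2) ^ (p/2)) =
        ∫ x, V x * ((φ x ^ 2 + ε ^ 2) ^ (p/2) - (ε^2) ^ (p/2)) := by
      intro ε
      apply setIntegral_eq_integral_of_forall_compl_eq_zero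
      intro x hx
      simp [hφ0 x hx]
    have r2 : ∀ ε : ℝ, ∫ x in tsupport φ,
        V x * ‖x‖ * ‖fderiv ℝ φ x‖ * (φ x ^ 2 + ε ^ 2) ^ ((p-1)/2) =
        ∫ x, V x * ‖x‖ * ‖fderiv ℝ φ x‖ * (φ x ^ 2 + ε ^ 2) ^ ((p-1)/2) := by
      intro ε
      apply setIntegral_eq_integral_of_forall_compl_eq_zero
      intro x hx
      simp [fderiv_zero_of hx]
    simp only [r1] at c1
    simp only [r2] at c2
    have t1 := ((c1.const_mul (d + min δ δ' - p)).tendsto 0).mono_left (nhdsWithin_le_nhds (s := Ioi 0))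
    have t2 := ((c2.const_mul p).tendsto 0).mono_left (nhdsWithin_le_nhds (s := Ioi 0))
    have key := le_of_tendsto_of_tendsto t1 t2 (by
      filter_upwards [self_mem_nhdsWithin] with ε hε
      exact lower_eps hp hε h1 h2 h3 hV hV0 hVV)
    have sq : ∀ (q s : ℝ), (s ^ 2) ^ (q/2) = |s| ^ q := by
      intro q s
      rw [← sq_abs, ← Real.rpow_natCast, ← Real.rpow_mul (abs_nonneg _)]
      congr 1; push_cast; ring
    simpa [sq, Real.zero_rpow hp0.ne', Real.zero_rpow (half_pos hp0).ne'] using key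
  rw [hden, hnum, le_div_iff₀ hApos]
  set κ := ((d : ℝ) + min δ δ' - p) / p with hκ
  have hκ0 : 0 < κ := by positivity
  have hpt : ∀ x, p * κ ^ (p-1) * (V x * ‖x‖ * ‖fderiv ℝ φ x‖ * |φ x| ^ (p-1)) ≤
      (p-1) * κ ^ p * (V x * |φ x| ^ p) + V x * (‖x‖ * ‖fderiv ℝ φ x‖) ^ p := by
    intro x
    have := aux_young hp (mul_nonneg hκ0.le (abs_nonneg (φ x)))
      (mul_nonneg (norm_nonneg x) (norm_nonneg (fderiv ℝ φ x)))
    rw [Real.mul_rpow hκ0.le (abs_nonneg _), Real.mul_rpow hκ0.le (abs_nonneg _)] at this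
    have := mul_le_mul_of_nonneg_left this (hV0 x)
    linarith
  have hI := integral_mono (iC.const_mul (p * κ ^ (p-1)))
    ((iA.const_mul ((p-1) * κ ^ p)).add iB) hpt
  simp only [Pi.add_apply] at hI
  rw [integral_add (iA.const_mul _) iB, integral_const_mul, integral_const_mul] at hI
  have hκp : κ ^ p = κ ^ (p-1) * κ := by
    rw [← Real.rpow_add_one hκ0.ne']; simp
  have hd : (d : ℝ) + min δ δ' - p = p * κ := by rw [hκ]; field_simp
  rw [hd] at hlim
  have h5 := mul_le_mul_of_nonneg_left hlim (Real.rpow_nonneg hκ0.le (p-1))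
  rw [hκp] at hI ⊢
  linarith

lemma radial_int {d : ℕ} (hd : 1 ≤ d) : ∃ C : ℝ, C ≠ 0 ∧ ∀ (a b : ℝ), 0 < b → ∀ G : ℝ → ℝ,
    ∫ x in ({0}ᶜ : Set (EuclideanSpace ℝ (Fin d))), G ‖x‖ =
      (C * b) * ∫ τ : ℝ, Real.exp (a + b * τ) ^ (d:ℝ) * G (Real.exp (a + b * τ)) := by
  have : Nonempty (Fin d) := ⟨⟨0, hd⟩⟩
  have : Nontrivial (EuclideanSpace ℝ (Fin d)) := inferInstance
  refine ⟨d * volume.real (Metric.ball (0 : EuclideanSpace ℝ (Fin d)) 1), ?_, ?_⟩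
  · have h1 : 0 < volume.real (Metric.ball (0 : EuclideanSpace ℝ (Fin d)) 1) :=
      ENNReal.toReal_pos (Metric.measure_ball_pos _ _ one_pos).ne' measure_ball_lt_top.ne
    have : (0:ℝ) < d := by exact_mod_cast hd
    positivity
  · intro a b hb G
    rw [restrict_compl_singleton, integral_fun_norm_addHaar]
    have him : (fun τ : ℝ => Real.exp (a + b * τ)) '' univ = Ioi 0 := by
      ext y
      simp only [image_univ, mem_range, mem_Ioi]
      constructor
      · rintro ⟨t, rfl⟩; positivity
      · intro hy
        refine ⟨(Real.log y - a) / b, ?_⟩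
        rw [mul_div_cancel₀ _ hb.ne', add_sub_cancel, Real.exp_log hy]
    rw [← him, integral_image_eq_integral_abs_deriv_smul (f' := fun τ => Real.exp (a + b * τ) * b) MeasurableSet.univ]
    · simp only [Measure.restrict_univ, finrank_euclideanSpace, Fintype.card_fin, smul_eq_mul, nsmul_eq_mul]
      have : ∀ τ : ℝ, |Real.exp (a + b * τ) * b| * (Real.exp (a + b * τ) ^ (d-1) * G (Real.exp (a + b * τ)))
        = b * (Real.exp (a + b * τ) ^ (d:ℝ) * G (Real.exp (a + b * τ))) := by
        intro τ
        rw [abs_of_pos (by positivity), Real.rpow_natCast]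
        obtain ⟨k, rfl⟩ := Nat.exists_eq_add_of_le' hd
        simp only [Nat.add_sub_cancel, pow_succ]
        ring
      simp only [this]
      rw [integral_const_mul]
      ring
    · intro x _
      have : HasDerivAt (fun τ : ℝ => a + b * τ) b x := by
        simpa using ((hasDerivAt_id x).const_mul b).const_add a
      exact this.exp.hasDerivWithinAt
    · intro x _ y _ hxy
      have := Real.exp_injective hxy
      have : b * x = b * y := by linarith
      exact mul_left_cancel₀ hb.ne' this

def GG (ψ : ℝ → ℝ) (κ a b r : ℝ) : ℝ := r ^ (-κ) * ψ ((Real.log r - a) / b)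

lemma GG_deriv {ψ : ℝ → ℝ} (hψ : ContDiff ℝ 1 ψ) {κ a b r : ℝ} (hr : 0 < r) :
    HasDerivAt (GG ψ κ a b) (r ^ (-κ-1) * (deriv ψ ((Real.log r - a) / b) / b
      - κ * ψ ((Real.log r - a) / b))) r := by
  have h1 := Real.hasDerivAt_rpow_const (x := r) (p := -κ) (Or.inl hr.ne')
  have h2 := ((Real.hasDerivAt_log hr.ne').sub_const a).div_const b
  have h3 := ((hψ.differentiable one_ne_zero) ((Real.log r - a) / b)).hasDerivAt
  have h4 := h3.comp r h2
  refine (h1.mul h4).congr_deriv ?_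
  rw [Real.rpow_sub_one hr.ne']
  simp only [Function.comp]
  field_simp
  ring

lemma GG_exp {ψ : ℝ → ℝ} {κ a b τ : ℝ} (hb : 0 < b) :
    GG ψ κ a b (Real.exp (a + b * τ)) = Real.exp (a + b * τ) ^ (-κ) * ψ τ := by
  unfold GG
  rw [Real.log_exp]
  congr 2
  field_simp; ring

lemma GG_contDiffAt {ψ : ℝ → ℝ} (hψ : ContDiff ℝ 1 ψ) {κ a b r : ℝ} (hr : 0 < r) :
    ContDiffAt ℝ 1 (GG ψ κ a b) r := by
  unfold GG
  refine ContDiffAt.mul (contDiffAt_id.rpow_const_of_ne hr.ne') ?_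
  refine hψ.contDiffAt.comp r ?_
  exact ((Real.contDiffAt_log.2 hr.ne').sub contDiffAt_const).div_const b

lemma upper_mem {d : ℕ} (hd : 1 ≤ d) {p δ δ' κ : ℝ} (hp : 1 ≤ p)
    (hκ : κ * p + p = d + min δ δ') (hκ0 : 0 < κ) {ψ : ℝ → ℝ} (hψ : ContDiff ℝ 1 ψ)
    (hψs : ∀ t, ψ t ≠ 0 → |t| ≤ 2) (hψ0 : ψ 0 = 1) {a b : ℝ} (hb : 0 < b) :
    ∃ φ : EuclideanSpace ℝ (Fin d) → ℝ,
        ContDiff ℝ 1 φ ∧ HasCompactSupport φ ∧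
        tsupport φ ⊆ ({0}ᶜ : Set (EuclideanSpace ℝ (Fin d))) ∧ φ ≠ 0 ∧
        (∫ τ : ℝ, (Real.exp (a + b * τ) ^ (δ - min δ δ') * (1 + Real.exp (a + b * τ)) ^ (δ' - δ)) *
            |deriv ψ τ / b - κ * ψ τ| ^ p) /
        (∫ τ : ℝ, (Real.exp (a + b * τ) ^ (δ - min δ δ') * (1 + Real.exp (a + b * τ)) ^ (δ' - δ)) *
            |ψ τ| ^ p) = (∫ x in ({0}ᶜ : Set (EuclideanSpace ℝ (Fin d))),
              (‖x‖ ^ δ * (1 + ‖x‖) ^ (δ' - δ)) * ‖gradient φ x‖ ^ p) /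
            (∫ x in ({0}ᶜ : Set (EuclideanSpace ℝ (Fin d))),
              (‖x‖ ^ δ * (1 + ‖x‖) ^ (δ' - δ)) * ‖x‖ ^ (-p) * |φ x| ^ p) := by
  have : Nonempty (Fin d) := ⟨⟨0, hd⟩⟩
  have : Nontrivial (EuclideanSpace ℝ (Fin d)) := inferInstance
  have hp0 : 0 < p := by linarith
  let φ : EuclideanSpace ℝ (Fin d) → ℝ := fun x => GG ψ κ a b ‖x‖
  have hts : tsupport φ ⊆ {x | Real.exp (a - 2 * b) ≤ ‖x‖ ∧ ‖x‖ ≤ Real.exp (a + 2 * b)} := by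
    apply closure_minimal
    · intro x hx
      have hx1 : ‖x‖ ^ (-κ) * ψ ((Real.log ‖x‖ - a) / b) ≠ 0 := hx
      have hx0 : 0 < ‖x‖ := by
        rcases (norm_nonneg x).eq_or_lt with h | h
        · rw [← h, Real.zero_rpow (by linarith)] at hx1
          simp at hx1
        · exact h
      have h2 := abs_le.1 (hψs _ (right_ne_zero_of_mul hx1))
      rw [le_div_iff₀ hb, div_le_iff₀ hb] at h2
      constructor
      · rw [← Real.le_log_iff_exp_le hx0]; linarith
      · rw [← Real.log_le_iff_le_exp hx0]; linarith
    · exact (isClosed_le continuous_const continuous_norm).inter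
        (isClosed_le continuous_norm continuous_const)
  have hts0 : tsupport φ ⊆ ({0}ᶜ : Set (EuclideanSpace ℝ (Fin d))) := by
    intro x hx h0
    have h0 : x = 0 := h0
    have := (hts hx).1
    rw [h0, norm_zero] at this
    linarith [Real.exp_pos (a - 2 * b)]
  have hgr : ∀ x : EuclideanSpace ℝ (Fin d), x ≠ 0 → ‖gradient φ x‖ = |deriv (GG ψ κ a b) ‖x‖| := by
    intro x hx
    have hr := norm_pos_iff.2 hx
    have hn := (contDiffAt_norm (n := 1) ℝ hx).differentiableAt one_ne_zero
    have h1 : HasFDerivAt φ _ x := (GG_deriv hψ (κ := κ) (a := a) (b := b) hr).comp_hasFDerivAt x hn.hasFDerivAt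
    have : ‖gradient φ x‖ = ‖fderiv ℝ φ x‖ := by simp [gradient]
    rw [this, h1.fderiv, norm_smul, norm_fderiv_norm hn, (GG_deriv hψ hr).deriv, mul_one, Real.norm_eq_abs]
  refine ⟨φ, ?_, ?_, hts0, ?_, ?_⟩
  · apply contDiff_of_ts
    intro x hx
    have hx0 : x ≠ 0 := hts0 hx
    exact ContDiffAt.comp (g := GG ψ κ a b) x (GG_contDiffAt hψ (norm_pos_iff.2 hx0)) (contDiffAt_norm ℝ hx0)
  · refine HasCompactSupport.of_support_subset_isCompact
      (isCompact_closedBall (0 : EuclideanSpace ℝ (Fin d)) (Real.exp (a + 2 * b))) ?_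
    intro x hx
    simpa using (hts (subset_tsupport _ hx)).2
  · intro h
    have := congrFun h (EuclideanSpace.single ⟨0, hd⟩ (Real.exp a))
    simp [φ, GG, hψ0] at this
    exact (Real.rpow_pos_of_pos (Real.exp_pos a) _).ne' this
  · obtain ⟨C, hC, hrad⟩ := radial_int hd
    have e1 : ∫ x in ({0}ᶜ : Set (EuclideanSpace ℝ (Fin d))),
              (‖x‖ ^ δ * (1 + ‖x‖) ^ (δ' - δ)) * ‖gradient φ x‖ ^ p =
        ∫ x in ({0}ᶜ : Set (EuclideanSpace ℝ (Fin d))),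
          (fun r : ℝ => (r ^ δ * (1 + r) ^ (δ' - δ)) * |deriv (GG ψ κ a b) r| ^ p) ‖x‖ := by
      apply setIntegral_congr_fun (measurableSet_singleton _).compl
      intro x hx
      simp only [hgr x hx]
    have e2 : ∫ x in ({0}ᶜ : Set (EuclideanSpace ℝ (Fin d))),
              (‖x‖ ^ δ * (1 + ‖x‖) ^ (δ' - δ)) * ‖x‖ ^ (-p) * |φ x| ^ p =
        ∫ x in ({0}ᶜ : Set (EuclideanSpace ℝ (Fin d))),
          (fun r : ℝ => (r ^ δ * (1 + r) ^ (δ' - δ)) * r ^ (-p) * |GG ψ κ a b r| ^ p) ‖x‖ := rfl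
    rw [e1.trans (hrad a b hb (fun r : ℝ => (r ^ δ * (1 + r) ^ (δ' - δ)) * |deriv (GG ψ κ a b) r| ^ p)),
      e2.trans (hrad a b hb (fun r : ℝ => (r ^ δ * (1 + r) ^ (δ' - δ)) * r ^ (-p) * |GG ψ κ a b r| ^ p)), mul_div_mul_left _ _ (mul_ne_zero hC hb.ne')]
    have hpow : ∀ r : ℝ, 0 < r → r ^ (δ - min δ δ') = r ^ (d:ℝ) * r ^ δ * r ^ (-p) * r ^ (-κ * p) := by
      intro r hr
      rw [← Real.rpow_add hr, ← Real.rpow_add hr, ← Real.rpow_add hr]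
      congr 1; linarith
    congr 1
    · congr 1; ext τ
      have hr := Real.exp_pos (a + b * τ)
      rw [(GG_deriv hψ hr).deriv, Real.log_exp, show (a + b * τ - a) / b = τ by field_simp; ring]
      rw [abs_mul, Real.mul_rpow (abs_nonneg _) (abs_nonneg _), abs_of_pos (Real.rpow_pos_of_pos hr _),
        ← Real.rpow_mul hr.le, hpow _ hr, show (-κ - 1) * p = -p + -κ * p by ring, Real.rpow_add hr]
      ring
    · congr 1; ext τ
      have hr := Real.exp_pos (a + b * τ)
      rw [GG_exp hb, abs_mul, Real.mul_rpow (abs_nonneg _) (abs_nonneg _), abs_of_pos (Real.rpow_pos_of_pos hr _),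
        ← Real.rpow_mul hr.le, hpow _ hr]
      ring

open Filter Topology in
lemma weight_lim {δ δ' : ℝ} : ∃ s C : ℝ,
    (∀ τ : ℝ, Tendsto (fun n : ℕ => Real.exp (s * (n:ℝ)^2 + n * τ) ^ (δ - min δ δ') *
      (1 + Real.exp (s * (n:ℝ)^2 + n * τ)) ^ (δ' - δ)) atTop (𝓝 1)) ∧
    (∀ (n : ℕ) (τ : ℝ), 2 ≤ n → |τ| ≤ 2 → Real.exp (s * (n:ℝ)^2 + n * τ) ^ (δ - min δ δ') *
      (1 + Real.exp (s * (n:ℝ)^2 + n * τ)) ^ (δ' - δ) ≤ C) := by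
  have key : ∀ τ : ℝ, Tendsto (fun n : ℕ => (1 + Real.exp (-((n:ℝ)^2 + n * τ))) ^ (δ' - δ)) atTop (𝓝 1) := by
    intro τ
    have h1 : Tendsto (fun n : ℕ => (n:ℝ)) atTop atTop := tendsto_natCast_atTop_atTop
    have h2 : Tendsto (fun n : ℕ => (n:ℝ) * (n + τ)) atTop atTop :=
      h1.atTop_mul_atTop₀ (tendsto_atTop_add_const_right _ _ h1)
    have h3 : Tendsto (fun n : ℕ => 1 + Real.exp (-((n:ℝ)^2 + n * τ))) atTop (𝓝 (1 + 0)) := by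
      refine tendsto_const_nhds.add ?_
      refine Real.tendsto_exp_neg_atTop_nhds_zero.comp (h2.congr ?_)
      intro n; ring
    have h4 := h3.rpow_const (p := δ' - δ) (Or.inl (by norm_num))
    simpa using h4
  rcases le_total δ δ' with h | h
  · refine ⟨-1, 2 ^ (δ' - δ), ?_, ?_⟩
    · intro τ
      refine (key (-τ)).congr ?_
      intro n
      rw [min_eq_left h, sub_self, Real.rpow_zero, one_mul]
      congr 3; ring
    · intro n τ hn hτ
      rw [min_eq_left h, sub_self, Real.rpow_zero, one_mul]
      refine Real.rpow_le_rpow (by positivity) ?_ (by linarith)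
      have : Real.exp (-1 * (n:ℝ)^2 + n * τ) ≤ 1 := by
        rw [Real.exp_le_one_iff]
        have : (2:ℝ) ≤ n := by exact_mod_cast hn
        nlinarith [(abs_le.1 hτ).2]
      linarith
  · have he : ∀ u : ℝ, Real.exp u ^ (δ - min δ δ') * (1 + Real.exp u) ^ (δ' - δ) =
        (1 + Real.exp (-u)) ^ (δ' - δ) := by
      intro u
      rw [min_eq_right h, show δ - δ' = -(δ' - δ) by ring, Real.rpow_neg (by positivity),
        ← Real.inv_rpow (by positivity), ← Real.mul_rpow (by positivity) (by positivity), ← Real.exp_neg]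
      congr 1
      rw [mul_add, ← Real.exp_add]; simp; ring
    refine ⟨1, 1, ?_, ?_⟩
    · intro τ
      refine (key τ).congr ?_
      intro n
      rw [he, one_mul]
    · intro n τ hn hτ
      rw [he]
      apply Real.rpow_le_one_of_one_le_of_nonpos
      · linarith [Real.exp_pos (-(1 * (n:ℝ)^2 + n * τ))]
      · linarith

open Filter Topology in
lemma dct {W F : ℕ → ℝ → ℝ} {F0 : ℝ → ℝ} {C B : ℝ}
    (hW : ∀ τ, Tendsto (fun n => W n τ) atTop (𝓝 1))
    (hW0 : ∀ n τ, 0 ≤ W n τ)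
    (hWC : ∀ n τ, 2 ≤ n → |τ| ≤ 2 → W n τ ≤ C)
    (hWm : ∀ n, Continuous (W n)) (hFm : ∀ n, Continuous (F n))
    (hF : ∀ τ, Tendsto (fun n => F n τ) atTop (𝓝 (F0 τ)))
    (hFB : ∀ n τ, 2 ≤ n → |F n τ| ≤ B) (hFs : ∀ n τ, 2 < |τ| → F n τ = 0) :
    Tendsto (fun n => ∫ τ, W n τ * F n τ) atTop (𝓝 (∫ τ, F0 τ)) := by
  apply tendsto_integral_filter_of_dominated_convergence
    ((Icc (-2:ℝ) 2).indicator (fun _ => C * B))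
  · exact Eventually.of_forall fun n => ((hWm n).mul (hFm n)).aestronglyMeasurable
  · filter_upwards [eventually_ge_atTop 2] with n hn
    refine Eventually.of_forall fun τ => ?_
    by_cases hτ : |τ| ≤ 2
    · rw [indicator_of_mem (by exact abs_le.1 hτ), norm_mul, Real.norm_eq_abs, Real.norm_eq_abs, abs_of_nonneg (hW0 n τ)]
      exact mul_le_mul (hWC n τ hn hτ) (hFB n τ hn) (abs_nonneg _) ((hW0 n τ).trans (hWC n τ hn hτ))
    · rw [indicator_of_notMem (fun h : τ ∈ Icc (-2:ℝ) 2 => hτ (abs_le.2 h)), hFs n τ (not_le.1 hτ)]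
      simp
  · rw [integrable_indicator_iff measurableSet_Icc]
    exact integrableOn_const (by simp)
  · refine Eventually.of_forall fun τ => ?_
    simpa using (hW τ).mul (hF τ)

open Filter Topology in
lemma upper_lim {p δ δ' κ : ℝ} (hp : 1 ≤ p) (hκ0 : 0 < κ) {ψ : ℝ → ℝ} (hψ : ContDiff ℝ 1 ψ)
    (hψs : ∀ t, ψ t ≠ 0 → |t| ≤ 2) (hψ0 : ψ 0 = 1) : ∃ s : ℝ,
    Tendsto (fun n : ℕ => (∫ τ : ℝ, (Real.exp (s * (n:ℝ)^2 + n * τ) ^ (δ - min δ δ') *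
        (1 + Real.exp (s * (n:ℝ)^2 + n * τ)) ^ (δ' - δ)) * |deriv ψ τ / n - κ * ψ τ| ^ p) /
      (∫ τ : ℝ, (Real.exp (s * (n:ℝ)^2 + n * τ) ^ (δ - min δ δ') *
        (1 + Real.exp (s * (n:ℝ)^2 + n * τ)) ^ (δ' - δ)) * |ψ τ| ^ p)) atTop (𝓝 (κ ^ p)) := by
  obtain ⟨s, C, hW, hWC⟩ := weight_lim (δ := δ) (δ' := δ')
  have hp0 : 0 < p := by linarith
  have hcs : HasCompactSupport ψ := HasCompactSupport.of_support_subset_isCompact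
    (isCompact_Icc (a := -2) (b := 2)) (fun t ht => abs_le.1 (hψs t ht))
  have hc := hψ.continuous
  have hcd : Continuous (deriv ψ) := hψ.continuous_deriv le_rfl
  have hd0 : ∀ t, 2 < |t| → deriv ψ t = 0 := by
    intro t ht
    by_contra h
    have h1 : t ∈ tsupport ψ := tsupport_deriv_subset (subset_tsupport _ h)
    have h2 : tsupport ψ ⊆ Icc (-2) 2 := closure_minimal (fun t ht => abs_le.1 (hψs t ht)) isClosed_Icc
    exact absurd (abs_le.2 (h2 h1)) (not_le.2 ht)
  have hz : ∀ t, 2 < |t| → ψ t = 0 := by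
    intro t ht
    by_contra h
    exact absurd (hψs t h) (not_le.2 ht)
  obtain ⟨M, hM⟩ := hcs.exists_bound_of_continuous hc
  obtain ⟨M', hM'⟩ := hcs.deriv.exists_bound_of_continuous hcd
  refine ⟨s, ?_⟩
  have hWc : ∀ n : ℕ, Continuous (fun τ : ℝ => Real.exp (s * (n:ℝ)^2 + n * τ) ^ (δ - min δ δ') *
        (1 + Real.exp (s * (n:ℝ)^2 + n * τ)) ^ (δ' - δ)) := by
    intro n
    refine Continuous.mul (Continuous.rpow_const (by fun_prop) ?_) (Continuous.rpow_const (by fun_prop) ?_)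
    · intro x; left; positivity
    · intro x; left; positivity
  have hpos : 0 < ∫ τ, |ψ τ| ^ p := by
    refine Continuous.integral_pos_of_hasCompactSupport_nonneg_nonzero (x := 0)
      (hc.abs.rpow_const (fun _ => Or.inr hp0.le)) ?_ ?_ ?_
    · refine hcs.mono ?_
      intro x hx h0
      exact hx (by simp [show ψ x = 0 from h0, Real.zero_rpow hp0.ne'])
    · intro x; positivity
    · simp [hψ0]
  have l2 := dct (F := fun n τ => |ψ τ| ^ p) (F0 := fun τ => |ψ τ| ^ p) (B := M ^ p) hW
    (fun n τ => by positivity) hWC hWc (fun _ => hc.abs.rpow_const (fun _ => Or.inr hp0.le))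
    (fun _ => tendsto_const_nhds)
    (fun n τ _ => by
      rw [abs_of_nonneg (by positivity)]
      exact Real.rpow_le_rpow (abs_nonneg _) (hM τ) hp0.le)
    (fun n τ h => by simp [hz τ h, Real.zero_rpow hp0.ne'])
  have l1 := dct (F := fun n τ => |deriv ψ τ / n - κ * ψ τ| ^ p) (F0 := fun τ => κ ^ p * |ψ τ| ^ p)
    (B := (M' + κ * M) ^ p) hW
    (fun n τ => by positivity) hWC hWc
    (fun n => Continuous.rpow_const (by fun_prop) (fun _ => Or.inr hp0.le))
    (fun τ => by
      have h1 : Tendsto (fun n : ℕ => deriv ψ τ / (n:ℝ) - κ * ψ τ) atTop (𝓝 (0 - κ * ψ τ)) :=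
        (tendsto_const_div_atTop_nhds_zero_nat _).sub tendsto_const_nhds
      have h2 := h1.abs.rpow_const (p := p) (Or.inr hp0.le)
      rwa [zero_sub, abs_neg, abs_mul, abs_of_pos hκ0, Real.mul_rpow hκ0.le (abs_nonneg _)] at h2)
    (fun n τ hn => by
      rw [abs_of_nonneg (by positivity)]
      refine Real.rpow_le_rpow (abs_nonneg _) ?_ hp0.le
      refine (abs_sub _ _).trans (add_le_add ?_ ?_)
      · rw [abs_div]
        refine (div_le_self (abs_nonneg _) ?_).trans (hM' τ)
        have : (2:ℝ) ≤ n := by exact_mod_cast hn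
        rw [abs_of_pos (by linarith)]; linarith
      · rw [abs_mul, abs_of_pos hκ0]
        exact mul_le_mul_of_nonneg_left (hM τ) hκ0.le)
    (fun n τ h => by simp [hz τ h, hd0 τ h, Real.zero_rpow hp0.ne'])
  have := l1.div l2 hpos.ne'
  rw [integral_const_mul, mul_div_cancel_right₀ _ hpos.ne'] at this
  exact this

/-- Optimality of the Hardy constant on `ℝ^d \ {0}` (Proposition 4.1 of the paper):
the optimal constant `μ_p(Ω)` equals `((d + min(δ,δ') − p)/p)^p`. -/
theorem hardy_optimal_constant_punctured
    (d : ℕ) (hd : 1 ≤ d)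
    (p δ δ' : ℝ) (hp : 1 ≤ p) (hδ : 0 ≤ δ) (hδ' : 0 ≤ δ')
    (hcond : 0 < (d : ℝ) + min δ δ' - p) :
    sInf { r : ℝ | ∃ φ : EuclideanSpace ℝ (Fin d) → ℝ,
        ContDiff ℝ 1 φ ∧ HasCompactSupport φ ∧
        tsupport φ ⊆ ({0}ᶜ : Set (EuclideanSpace ℝ (Fin d))) ∧ φ ≠ 0 ∧
        r = (∫ x in ({0}ᶜ : Set (EuclideanSpace ℝ (Fin d))),
              (‖x‖ ^ δ * (1 + ‖x‖) ^ (δ' - δ)) * ‖gradient φ x‖ ^ p) /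
            (∫ x in ({0}ᶜ : Set (EuclideanSpace ℝ (Fin d))),
              (‖x‖ ^ δ * (1 + ‖x‖) ^ (δ' - δ)) * ‖x‖ ^ (-p) * |φ x| ^ p) }
      = (((d : ℝ) + min δ δ' - p) / p) ^ p := by
  have hp0 : 0 < p := by linarith
  set κ := ((d : ℝ) + min δ δ' - p) / p with hκ
  have hκ0 : 0 < κ := by positivity
  have hκ1 : κ * p + p = d + min δ δ' := by rw [hκ]; field_simp; ring
  let B : ContDiffBump (0 : ℝ) := ⟨1, 2, one_pos, one_lt_two⟩
  have hψ : ContDiff ℝ 1 (B : ℝ → ℝ) := B.contDiff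
  have hψs : ∀ t, B t ≠ 0 → |t| ≤ 2 := by
    intro t ht
    have : t ∈ Function.support B := ht
    rw [B.support_eq] at this
    have h2 : |t| < 2 := by simpa [B] using this
    exact h2.le
  have hψ0 : B 0 = 1 := B.one_of_mem_closedBall (Metric.mem_closedBall_self B.rIn_pos.le)
  obtain ⟨s, hs⟩ := upper_lim (δ := δ) (δ' := δ') hp hκ0 hψ hψs hψ0
  refine le_antisymm ?_ ?_
  · refine ge_of_tendsto hs ?_
    filter_upwards [Filter.eventually_ge_atTop 1] with n hn
    have hn0 : (0:ℝ) < n := by exact_mod_cast hn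
    obtain ⟨φ, h1, h2, h3, h4, h5⟩ := upper_mem hd (a := s * (n:ℝ)^2) hp hκ1 hκ0 hψ hψs hψ0 hn0
    refine csInf_le ⟨κ ^ p, ?_⟩ ⟨φ, h1, h2, h3, h4, h5⟩
    rintro r ⟨φ, h1, h2, h3, h4, rfl⟩
    exact lower_bd hp hcond h1 h2 h3 h4
  · refine le_csInf ?_ ?_
    · obtain ⟨φ, h1, h2, h3, h4, h5⟩ := upper_mem hd (a := 0) hp hκ1 hκ0 hψ hψs hψ0 one_pos
      exact ⟨_, φ, h1, h2, h3, h4, rfl⟩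
    · rintro r ⟨φ, h1, h2, h3, h4, rfl⟩
      exact lower_bd hp hcond h1 h2 h3 h4
end
end

section
/- Assume k = dim(affine span of K) ∈ {1,…,d−1} (so d_H = k), p > 1, δ, δ' ≥ 0 and d − k + min(δ,δ') − p > 0. Then the optimal Hardy constant satisfies μ_p(Ω) ≤ ((d − k + δ − p)/p)^p. In particular, if δ ≤ δ' then μ_p(Ω) = ((d − k + δ − p)/p)^p. -/
open MeasureTheory Set

noncomputable section

/-- The optimal Hardy constant `μ_p(Ω)` for `Ω = ℝ^d \ K` with weight
`c_Ω = d_Γ^δ (1+d_Γ)^(δ'-δ)`. -/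
def muP (d : ℕ) (p δ δ' : ℝ) (K : Set (EuclideanSpace ℝ (Fin d))) : ℝ :=
  sInf { r : ℝ | ∃ φ : EuclideanSpace ℝ (Fin d) → ℝ,
    ContDiff ℝ 1 φ ∧ HasCompactSupport φ ∧ tsupport φ ⊆ Kᶜ ∧ φ ≠ 0 ∧
    r = (∫ x in Kᶜ,
          (Metric.infDist x K ^ δ * (1 + Metric.infDist x K) ^ (δ' - δ)) *
            ‖gradient φ x‖ ^ p) /
        (∫ x in Kᶜ,
          (Metric.infDist x K ^ δ * (1 + Metric.infDist x K) ^ (δ' - δ)) *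
            Metric.infDist x K ^ (-p) * |φ x| ^ p) }

set_option linter.unusedSectionVars false

section Geom

variable {E : Type*} [NormedAddCommGroup E] [InnerProductSpace ℝ E] [FiniteDimensional ℝ E]

/-- the linear map which is the identity on `V` and multiplication by `l` on its complement -/
def LL (V : Submodule ℝ E) (l : ℝ) : E →ₗ[ℝ] E :=
  (V.starProjection : E →ₗ[ℝ] E) + l • (Vᗮ.starProjection : E →ₗ[ℝ] E)

theorem LL_apply (V : Submodule ℝ E) (l : ℝ) (x : E) :
    LL V l x = V.starProjection x + l • Vᗮ.starProjection x := rfl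

theorem LL_det (V : Submodule ℝ E) (l : ℝ) :
    LinearMap.det (LL V l) = l ^ (Module.finrank ℝ E - Module.finrank ℝ V) := by
  have h1 : ∀ x ∈ V, LL V l x = x := by
    intro x hx
    rw [LL_apply, V.starProjection_eq_self_iff.2 hx, V.starProjection_orthogonal_apply_eq_zero hx]
    simp
  have he : V ≤ V.comap (LL V l) := by
    intro x hx
    simpa [h1 x hx] using hx
  rw [LinearMap.det_eq_det_mul_det V (LL V l) he]
  have e1 : (LL V l).restrict he = LinearMap.id := by
    ext x
    simp [LinearMap.restrict_apply, h1]
  have e2 : V.mapQ V (LL V l) he = l • LinearMap.id := by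
    ext x
    simp only [LinearMap.comp_apply, Submodule.mkQ_apply, Submodule.mapQ_apply,
      LinearMap.smul_apply, LinearMap.id_apply]
    rw [← Submodule.Quotient.mk_smul, Submodule.Quotient.eq, LL_apply,
      Submodule.starProjection_orthogonal_val, smul_sub]
    have : V.starProjection x + (l • x - l • V.starProjection x) - l • x
      = V.starProjection x - l • V.starProjection x := by abel
    rw [this]
    exact V.sub_mem (V.starProjection_apply_mem _) (V.smul_mem _ (V.starProjection_apply_mem _))
  rw [e1, e2, LinearMap.det_id, LinearMap.det_smul, LinearMap.det_id, one_mul, mul_one]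
  congr 1
  have := V.finrank_quotient_add_finrank
  omega

theorem exists_proj {K : Set E} (hne : K.Nonempty) (hcl : IsClosed K) (hc : Convex ℝ K) :
    ∃ P : E → E, (∀ x, P x ∈ K) ∧ ∀ x, ∀ w ∈ K, inner ℝ (x - P x) (w - P x) ≤ 0 := by
  choose P hP hP2 using exists_norm_eq_iInf_of_complete_convex hne hcl.isComplete hc
  exact ⟨P, hP, fun x => (norm_eq_iInf_iff_real_inner_le_zero hc (hP x)).1 (hP2 x)⟩

variable {K : Set E} {P : E → E}

theorem proj_infDist (hP : ∀ x, P x ∈ K) (hP2 : ∀ x, ∀ w ∈ K, inner ℝ (x - P x) (w - P x) ≤ 0)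
    (x : E) : Metric.infDist x K = ‖x - P x‖ := by
  apply le_antisymm
  · rw [← dist_eq_norm]
    exact Metric.infDist_le_dist_of_mem (hP x)
  · rw [Metric.le_infDist ⟨_, hP x⟩]
    intro w hw
    rw [dist_eq_norm]
    have h := hP2 x w hw
    have h2 : ‖x - w‖ ^ 2 = ‖x - P x‖ ^ 2 - 2 * inner ℝ (x - P x) (w - P x) + ‖w - P x‖ ^ 2 := by
      rw [← norm_sub_sq_real]; congr 2; abel
    refine (sq_le_sq₀ (norm_nonneg _) (norm_nonneg _)).1 ?_
    nlinarith [sq_nonneg ‖w - P x‖]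

theorem proj_unique (hP : ∀ x, P x ∈ K) (hP2 : ∀ x, ∀ w ∈ K, inner ℝ (x - P x) (w - P x) ≤ 0)
    {x y : E} (hy : y ∈ K) (h : ∀ w ∈ K, inner ℝ (x - y) (w - y) ≤ 0) : P x = y := by
  have h1 := hP2 x y hy
  have h2 := h (P x) (hP x)
  have : inner ℝ (x - P x) (y - P x) + inner ℝ (x - y) (P x - y) = ‖P x - y‖ ^ 2 := by
    rw [← real_inner_self_eq_norm_sq]
    simp only [inner_sub_left, inner_sub_right]
    ring
  have h3 : ‖P x - y‖ = 0 := by nlinarith [sq_nonneg ‖P x - y‖]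
  exact sub_eq_zero.1 (norm_eq_zero.1 h3)

theorem proj_fne (hP : ∀ x, P x ∈ K) (hP2 : ∀ x, ∀ w ∈ K, inner ℝ (x - P x) (w - P x) ≤ 0)
    (x y : E) : ‖P x - P y‖ ^ 2 ≤ inner ℝ (P x - P y) (x - y) := by
  have h1 := hP2 x (P y) (hP y)
  have h2 := hP2 y (P x) (hP x)
  have : inner ℝ (P x - P y) (x - y) - ‖P x - P y‖ ^ 2
    = - inner ℝ (x - P x) (P y - P x) - inner ℝ (y - P y) (P x - P y) := by
    rw [← real_inner_self_eq_norm_sq]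
    simp only [inner_sub_left, inner_sub_right]
    rw [real_inner_comm x, real_inner_comm x, real_inner_comm y, real_inner_comm y]
    ring
  linarith

/-- the dilation about the projection -/
def TT (P : E → E) (l : ℝ) (x : E) : E := P x + l • (x - P x)

theorem proj_TT (hP : ∀ x, P x ∈ K) (hP2 : ∀ x, ∀ w ∈ K, inner ℝ (x - P x) (w - P x) ≤ 0)
    {l : ℝ} (hl : 0 ≤ l) (x : E) : P (TT P l x) = P x := by
  apply proj_unique hP hP2 (hP x)
  intro w hw
  have : TT P l x - P x = l • (x - P x) := by simp [TT]
  rw [this, real_inner_smul_left]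
  exact mul_nonpos_of_nonneg_of_nonpos hl (hP2 x w hw)

theorem TT_TT (hP : ∀ x, P x ∈ K) (hP2 : ∀ x, ∀ w ∈ K, inner ℝ (x - P x) (w - P x) ≤ 0)
    {l m : ℝ} (hl : 0 ≤ l) (hm : m * l = 1) (x : E) : TT P m (TT P l x) = x := by
  rw [TT, proj_TT hP hP2 hl]
  simp [TT, smul_smul, hm]

theorem infDist_TT (hP : ∀ x, P x ∈ K) (hP2 : ∀ x, ∀ w ∈ K, inner ℝ (x - P x) (w - P x) ≤ 0)
    {l : ℝ} (hl : 0 ≤ l) (x : E) :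
    Metric.infDist (TT P l x) K = l * Metric.infDist x K := by
  rw [proj_infDist hP hP2, proj_infDist hP hP2, proj_TT hP hP2 hl]
  simp [TT, norm_smul, abs_of_nonneg hl]

theorem proj_lip (hP : ∀ x, P x ∈ K) (hP2 : ∀ x, ∀ w ∈ K, inner ℝ (x - P x) (w - P x) ≤ 0) :
    Continuous P := by
  have : LipschitzWith 1 P := by
    apply LipschitzWith.of_dist_le_mul
    intro x y
    rw [dist_eq_norm, dist_eq_norm, NNReal.coe_one, one_mul]
    have h1 := proj_fne hP hP2 x y
    have h2 := real_inner_le_norm (P x - P y) (x - y)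
    by_contra! h
    nlinarith [norm_nonneg (P x - P y), norm_nonneg (x - y)]
  exact this.continuous

variable [MeasurableSpace E] [BorelSpace E] (μ : Measure E) [μ.IsAddHaarMeasure]

theorem lip_image_le {f : E → E} (hf : LipschitzWith 1 f) (s : Set E) : μ (f '' s) ≤ μ s := by
  have := hf.hausdorffMeasure_image_le (d := Module.finrank ℝ E) (by positivity) s
  rw [Measure.isAddLeftInvariant_eq_smul μ (Measure.hausdorffMeasure (Module.finrank ℝ E : ℝ))]
  simp only [Measure.smul_apply, ENNReal.smul_def, smul_eq_mul]
  refine mul_le_mul_right ?_ _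
  simpa using this

theorem vol_TT (V : Submodule ℝ E) (hV : ∀ x ∈ K, ∀ y ∈ K, x - y ∈ V)
    (hP : ∀ x, P x ∈ K) (hP2 : ∀ x, ∀ w ∈ K, inner ℝ (x - P x) (w - P x) ≤ 0)
    {l : ℝ} (hl : 0 ≤ l) (hl1 : l ≤ 1) (s : Set E) :
    μ (TT P l '' s) ≤ ENNReal.ofReal (l ^ (Module.finrank ℝ E - Module.finrank ℝ V)) * μ s := by
  set x0 := P 0 with hx0
  let M : E → E := fun x => P x - x0 + l • V.starProjection (x - P x) + Vᗮ.starProjection (x - P x)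
  have hM : LipschitzWith 1 M := by
    apply LipschitzWith.of_dist_le_mul
    intro x y
    rw [dist_eq_norm, dist_eq_norm, NNReal.coe_one, one_mul]
    set q := P x - P y with hq
    have hqV : q ∈ V := hV _ (hP x) _ (hP y)
    set u := x - y with hu
    have e : M x - M y = ((1 - l) • q + l • V.starProjection u) + Vᗮ.starProjection u := by
      have e1 : M x - M y = q + l • V.starProjection (u - q) + Vᗮ.starProjection (u - q) := by
        simp only [M, map_sub, hq, hu, smul_sub]; abel
      rw [e1, map_sub _ u q, map_sub _ u q, V.starProjection_eq_self_iff.2 hqV,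
        V.starProjection_orthogonal_apply_eq_zero hqV]
      module
    set a := V.starProjection u with ha
    have haV : a ∈ V := V.starProjection_apply_mem _
    set b := Vᗮ.starProjection u with hb
    have hbV : b ∈ Vᗮ := Vᗮ.starProjection_apply_mem _
    have hqa : ‖q‖ ≤ ‖a‖ := by
      have h1 := proj_fne hP hP2 x y
      have h3 : inner ℝ (P x - P y) (x - y) = inner ℝ q a := by
        have : u = a + b := (V.starProjection_add_starProjection_orthogonal u).symm
        rw [← hq, ← hu, this, inner_add_right, V.inner_right_of_mem_orthogonal hqV hbV, add_zero]
      have h2 := real_inner_le_norm q a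
      rw [h3] at h1
      by_contra! h
      nlinarith [norm_nonneg q, norm_nonneg a]
    have hc : (1 - l) • q + l • a ∈ V := V.add_mem (V.smul_mem _ hqV) (V.smul_mem _ haV)
    have n1 : ‖(1 - l) • q + l • a‖ ≤ ‖a‖ := by
      calc _ ≤ ‖(1 - l) • q‖ + ‖l • a‖ := norm_add_le _ _
        _ = (1 - l) * ‖q‖ + l * ‖a‖ := by
          rw [norm_smul, norm_smul, Real.norm_of_nonneg hl, Real.norm_of_nonneg (by linarith)]
        _ ≤ ‖a‖ := by nlinarith
    have n2 := norm_add_sq_eq_norm_sq_add_norm_sq_of_inner_eq_zero _ _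
      (V.inner_right_of_mem_orthogonal hc hbV)
    have n3 := V.norm_sq_eq_add_norm_sq_starProjection u
    rw [e]
    refine (sq_le_sq₀ (norm_nonneg _) (norm_nonneg _)).1 ?_
    rw [n3, ← ha, ← hb]
    nlinarith [norm_nonneg ((1 - l) • q + l • a)]
  have hS : TT P l '' s = (fun x => x + x0) '' (LL V l '' (M '' s)) := by
    rw [image_image, image_image]
    apply image_congr
    intro x _
    have hqV : P x - x0 ∈ V := hV _ (hP x) _ (hP 0)
    have h1 : V.starProjection (V.starProjection (x - P x)) = V.starProjection (x - P x) :=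
      V.starProjection_eq_self_iff.2 (V.starProjection_apply_mem _)
    have h2 : Vᗮ.starProjection (Vᗮ.starProjection (x - P x)) = Vᗮ.starProjection (x - P x) :=
      Vᗮ.starProjection_eq_self_iff.2 (Vᗮ.starProjection_apply_mem _)
    have h3 : V.starProjection (Vᗮ.starProjection (x - P x)) = 0 :=
      V.starProjection_apply_eq_zero_iff.2 (Vᗮ.starProjection_apply_mem _)
    have h4 : Vᗮ.starProjection (V.starProjection (x - P x)) = 0 :=
      V.starProjection_orthogonal_apply_eq_zero (V.starProjection_apply_mem _)
    simp only [LL_apply, M, map_add, map_smul, h1, h2, h3, h4, V.starProjection_eq_self_iff.2 hqV,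
        V.starProjection_orthogonal_apply_eq_zero hqV, TT]
    conv_lhs => rw [← V.starProjection_add_starProjection_orthogonal (x - P x)]
    module
  rw [hS, image_add_right, measure_preimage_add_right, Measure.addHaar_image_linearMap, LL_det,
    abs_of_nonneg (by positivity)]
  exact mul_le_mul_right (lip_image_le μ hM s) _

/-- integral form -/
theorem lint_TT (V : Submodule ℝ E) (hV : ∀ x ∈ K, ∀ y ∈ K, x - y ∈ V)
    (hP : ∀ x, P x ∈ K) (hP2 : ∀ x, ∀ w ∈ K, inner ℝ (x - P x) (w - P x) ≤ 0)
    {l : ℝ} (hl : 1 ≤ l) {f : E → ENNReal} (hf : Measurable f) :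
    ∫⁻ x, f (TT P l x) ∂μ ≤
      ENNReal.ofReal (l⁻¹ ^ (Module.finrank ℝ E - Module.finrank ℝ V)) * ∫⁻ x, f x ∂μ := by
  have hl0 : 0 < l := by linarith
  have hT : Measurable (TT P l) := by
    have := proj_lip hP hP2
    unfold TT
    exact Continuous.measurable (by fun_prop)
  rw [← lintegral_map hf hT, ← smul_eq_mul, ← lintegral_smul_measure]
  refine lintegral_mono' ?_ le_rfl
  rw [Measure.le_iff]
  intro A hA
  rw [Measure.map_apply hT hA]
  have : TT P l ⁻¹' A = TT P l⁻¹ '' A := by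
    rw [image_eq_preimage_of_inverse]
    · intro x
      exact TT_TT hP hP2 (by positivity) (by field_simp) x
    · intro x
      exact TT_TT hP hP2 (by positivity) (by field_simp) x
  rw [this]
  exact vol_TT μ V hV hP hP2 (by positivity) (inv_le_one_of_one_le₀ hl) A

end Geom

section Lower

variable {E : Type*} [NormedAddCommGroup E] [InnerProductSpace ℝ E] [FiniteDimensional ℝ E]

/-- the weight -/
def cw (δ δ' s : ℝ) : ℝ := s ^ δ * (1 + s) ^ (δ' - δ)

theorem cw_nonneg {δ δ' s : ℝ} (hs : 0 ≤ s) : 0 ≤ cw δ δ' s := by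
  unfold cw; positivity

theorem cw_pos {δ δ' s : ℝ} (hs : 0 < s) : 0 < cw δ δ' s := by
  unfold cw; positivity

theorem cw_cont {δ δ' : ℝ} : ContinuousOn (cw δ δ') (Ioi 0) := by
  unfold cw
  intro s hs
  have hs : 0 < s := hs
  apply ContinuousAt.continuousWithinAt
  refine ContinuousAt.mul ?_ ?_
  · exact ContinuousAt.rpow_const continuousAt_id (Or.inl hs.ne')
  · exact ContinuousAt.rpow_const (by fun_prop) (Or.inl (by positivity))

theorem cw_scale {δ δ' p s l : ℝ} (hd : δ ≤ δ') (hs : 0 ≤ s) (hl : 1 ≤ l) :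
    l ^ (δ - p) * (cw δ δ' s * s ^ (-p)) ≤ cw δ δ' (l * s) * (l * s) ^ (-p) := by
  unfold cw
  have hl0 : 0 < l := by linarith
  rw [Real.mul_rpow hl0.le hs, Real.mul_rpow hl0.le hs, sub_eq_add_neg δ p, Real.rpow_add hl0]
  have : (1 + s) ^ (δ' - δ) ≤ (1 + l * s) ^ (δ' - δ) := by
    apply Real.rpow_le_rpow (by positivity) _ (by linarith)
    nlinarith
  calc _ = (l ^ δ * l ^ (-p) * s ^ δ * s ^ (-p)) * (1 + s) ^ (δ' - δ) := by ring
    _ ≤ (l ^ δ * l ^ (-p) * s ^ δ * s ^ (-p)) * (1 + l * s) ^ (δ' - δ) := by gcongr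
    _ = _ := by ring

theorem cts_mul {K : Set E} (hcl : IsClosed K) (hne : K.Nonempty) {F : ℝ → ℝ}
    (hF : ContinuousOn F (Ioi 0)) {g : E → ℝ} (hg : Continuous g) (hgK : tsupport g ⊆ Kᶜ) :
    Continuous fun x => F (Metric.infDist x K) * g x := by
  rw [continuous_iff_continuousAt]
  intro x
  by_cases hx : x ∈ tsupport g
  · have : 0 < Metric.infDist x K := (hcl.notMem_iff_infDist_pos hne).1 (hgK hx)
    apply ContinuousAt.mul _ hg.continuousAt
    exact ContinuousAt.comp (hF.continuousAt (Ioi_mem_nhds this))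
      (Metric.continuous_infDist_pt K).continuousAt
  · have : (fun x => F (Metric.infDist x K) * g x) =ᶠ[nhds x] fun _ => 0 := by
      filter_upwards [notMem_tsupport_iff_eventuallyEq.1 hx] with y hy
      simp [hy]
    exact continuousAt_const.congr this.symm

variable [MeasurableSpace E] [BorelSpace E] (μ : Measure E) [μ.IsAddHaarMeasure]

theorem int_mul {K : Set E} (hcl : IsClosed K) (hne : K.Nonempty) {F : ℝ → ℝ}
    (hF : ContinuousOn F (Ioi 0)) {g : E → ℝ} (hg : Continuous g) (hgc : HasCompactSupport g)
    (hgK : tsupport g ⊆ Kᶜ) :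
    Integrable (fun x => F (Metric.infDist x K) * g x) μ :=
  (cts_mul hcl hne hF hg hgK).integrable_of_hasCompactSupport hgc.mul_left

theorem wcont {δ δ' p : ℝ} : ContinuousOn (fun s => cw δ δ' s * s ^ (-p)) (Ioi 0) := by
  apply cw_cont.mul
  intro s hs
  exact (ContinuousAt.rpow_const continuousAt_id (Or.inl (ne_of_gt hs))).continuousWithinAt

theorem wmeas {δ δ' p : ℝ} (K : Set E) :
    Measurable (fun x : E => cw δ δ' (Metric.infDist x K) * Metric.infDist x K ^ (-p)) := by
  have := (Metric.continuous_infDist_pt K).measurable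
  unfold cw
  fun_prop

theorem step_ineq {K : Set E} {P : E → E} (hcl : IsClosed K) (V : Submodule ℝ E)
    (hV : ∀ x ∈ K, ∀ y ∈ K, x - y ∈ V)
    (hP : ∀ x, P x ∈ K) (hP2 : ∀ x, ∀ w ∈ K, inner ℝ (x - P x) (w - P x) ≤ 0)
    {δ δ' p : ℝ} (hd : δ ≤ δ')
    {g : E → ℝ} (hg : Continuous g) (hgc : HasCompactSupport g) (hgK : tsupport g ⊆ Kᶜ)
    (hg0 : ∀ x, 0 ≤ g x) {l : ℝ} (hl : 1 ≤ l) :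
    ∫ x, cw δ δ' (Metric.infDist x K) * Metric.infDist x K ^ (-p) * g (TT P l x) ∂μ ≤
      l ^ (-((Module.finrank ℝ E - Module.finrank ℝ V : ℕ) + δ - p)) *
      ∫ x, cw δ δ' (Metric.infDist x K) * Metric.infDist x K ^ (-p) * g x ∂μ := by
  set m := Module.finrank ℝ E - Module.finrank ℝ V with hm
  have hl0 : 0 < l := by linarith
  have hint := int_mul μ hcl ⟨_, hP 0⟩ (wcont (δ := δ) (δ' := δ') (p := p)) hg hgc hgK
  set f : E → ℝ := fun x => cw δ δ' (Metric.infDist x K) * Metric.infDist x K ^ (-p) * g x with hf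
  have hf0 : ∀ x, 0 ≤ f x := fun x => by
    have := cw_nonneg (δ := δ) (δ' := δ') (Metric.infDist_nonneg (x := x) (s := K))
    have h2 := Metric.infDist_nonneg (x := x) (s := K)
    have := hg0 x
    simp only [hf]
    positivity
  have hPc := proj_lip hP hP2
  have hT : Continuous (TT P l) := by
    unfold TT
    fun_prop
  have hfc : Continuous f := cts_mul hcl ⟨_, hP 0⟩ wcont hg hgK
  have h1 := lint_TT μ V hV hP hP2 hl (f := fun x => ENNReal.ofReal (f x)) (by fun_prop)
  rw [← hm] at h1
  have h2 : ∫ x, f (TT P l x) ∂μ ≤ l⁻¹ ^ m * ∫ x, f x ∂μ := by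
    rw [integral_eq_lintegral_of_nonneg_ae (Filter.Eventually.of_forall fun x => hf0 _)
      (hfc.comp hT).aestronglyMeasurable,
      integral_eq_lintegral_of_nonneg_ae (Filter.Eventually.of_forall fun x => hf0 _)
      hfc.aestronglyMeasurable]
    refine (ENNReal.toReal_mono ?_ h1).trans ?_
    · exact ENNReal.mul_ne_top ENNReal.ofReal_ne_top hint.lintegral_lt_top.ne
    · rw [ENNReal.toReal_mul, ENNReal.toReal_ofReal (by positivity)]
  have hint2 : Integrable (fun x => f (TT P l x)) μ := by
    refine ⟨(hfc.comp hT).aestronglyMeasurable, ?_⟩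
    rw [hasFiniteIntegral_iff_ofReal (Filter.Eventually.of_forall fun x => hf0 _)]
    refine h1.trans_lt (ENNReal.mul_lt_top ENNReal.ofReal_lt_top hint.lintegral_lt_top)
  have h3 : l ^ (δ - p) * ∫ x, cw δ δ' (Metric.infDist x K) * Metric.infDist x K ^ (-p)
      * g (TT P l x) ∂μ ≤ ∫ x, f (TT P l x) ∂μ := by
    rw [← integral_const_mul]
    refine integral_mono_of_nonneg (Filter.Eventually.of_forall fun x => ?_) hint2
      (Filter.Eventually.of_forall fun x => ?_)
    · have := cw_nonneg (δ := δ) (δ' := δ') (Metric.infDist_nonneg (x := x) (s := K))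
      have h2 := Metric.infDist_nonneg (x := x) (s := K)
      have := hg0 (TT P l x)
      simp only [Pi.zero_apply]
      positivity
    · simp only [hf, infDist_TT hP hP2 hl0.le]
      rw [← mul_assoc]
      exact mul_le_mul_of_nonneg_right (cw_scale hd Metric.infDist_nonneg hl) (hg0 _)
  have h4 : 0 < l ^ (δ - p) := by positivity
  rw [← mul_le_mul_iff_right₀ h4]
  refine h3.trans (h2.trans (le_of_eq ?_))
  rw [← mul_assoc, ← Real.rpow_add hl0]
  congr 1
  rw [inv_pow, ← Real.rpow_natCast, ← Real.rpow_neg hl0.le]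
  congr 1
  ring

theorem deriv_ineq {K : Set E} {P : E → E} (hcl : IsClosed K) (V : Submodule ℝ E)
    (hV : ∀ x ∈ K, ∀ y ∈ K, x - y ∈ V)
    (hP : ∀ x, P x ∈ K) (hP2 : ∀ x, ∀ w ∈ K, inner ℝ (x - P x) (w - P x) ≤ 0)
    {δ δ' p : ℝ} (hd : δ ≤ δ')
    {g : E → ℝ} (hg : ContDiff ℝ 1 g) (hgc : HasCompactSupport g) (hgK : tsupport g ⊆ Kᶜ)
    (hg0 : ∀ x, 0 ≤ g x) :
    ((Module.finrank ℝ E - Module.finrank ℝ V : ℕ) + δ - p) *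
      ∫ x, cw δ δ' (Metric.infDist x K) * Metric.infDist x K ^ (-p) * g x ∂μ ≤
     - ∫ x, cw δ δ' (Metric.infDist x K) * Metric.infDist x K ^ (-p) * fderiv ℝ g x (x - P x) ∂μ
      := by
  set m := Module.finrank ℝ E - Module.finrank ℝ V with hm
  set b := (m : ℝ) + δ - p with hb
  have hKne : K.Nonempty := ⟨_, hP 0⟩
  have hint := int_mul μ hcl hKne (wcont (δ := δ) (δ' := δ') (p := p)) hg.continuous hgc hgK
  set w : E → ℝ := fun x => cw δ δ' (Metric.infDist x K) * Metric.infDist x K ^ (-p) with hw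
  have hwm : Measurable w := wmeas K
  have hw0 : ∀ x, 0 ≤ w x := fun x => by
    have := cw_nonneg (δ := δ) (δ' := δ') (Metric.infDist_nonneg (x := x) (s := K))
    have h2 := Metric.infDist_nonneg (x := x) (s := K)
    simp only [hw]
    positivity
  have hPc := proj_lip hP hP2
  obtain ⟨C, hC⟩ := ContDiff.lipschitzWith_of_hasCompactSupport hgc hg one_ne_zero
  -- compactness constants
  obtain ⟨ε, hε, hεg⟩ : ∃ ε > 0, ∀ x ∈ tsupport g, ε ≤ Metric.infDist x K := by
    by_cases hne : (tsupport g).Nonempty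
    · obtain ⟨x0, hx0, hmin⟩ := hgc.isCompact.exists_isMinOn hne
        (Metric.continuous_infDist_pt K).continuousOn
      exact ⟨_, (hcl.notMem_iff_infDist_pos hKne).1 (hgK hx0), fun x hx => hmin hx⟩
    · exact ⟨1, one_pos, fun x hx => (hne ⟨x, hx⟩).elim⟩
  obtain ⟨R, hR⟩ : ∃ R, ∀ x ∈ tsupport g, ‖x‖ ≤ R := hgc.isCompact.isBounded.exists_norm_le
  obtain ⟨D, hD⟩ : ∃ D, ∀ x ∈ tsupport g, Metric.infDist x K ≤ D := by
    obtain ⟨D, hD⟩ := hgc.isCompact.exists_bound_of_continuousOn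
      (Metric.continuous_infDist_pt K).continuousOn
    exact ⟨D, fun x hx => (le_abs_self _).trans (hD x hx)⟩
  set B : Set E := Metric.closedBall 0 (R + |D|) ∩ {x | ε / 2 ≤ Metric.infDist x K} with hB
  have hBc : IsCompact B := (isCompact_closedBall _ _).inter_right
    (isClosed_le continuous_const (Metric.continuous_infDist_pt K))
  have hsB : tsupport g ⊆ B := by
    intro x hx
    refine ⟨?_, ?_⟩
    · simp only [Metric.mem_closedBall, dist_zero_right]
      have := hR x hx
      have := abs_nonneg D
      linarith
    · have := hεg x hx
      simp only [mem_ofPred_eq]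
      linarith
  have hTB : ∀ t ∈ Ioo (0:ℝ) 1, ∀ x, TT P (1 + t) x ∈ tsupport g → x ∈ B := by
    intro t ht x hx
    have h1 := hR _ hx
    have h2 := hD _ hx
    have h3 := hεg _ hx
    rw [infDist_TT hP hP2 (by linarith [ht.1])] at h2 h3
    have h0 := Metric.infDist_nonneg (x := x) (s := K)
    have ht1 := ht.1
    have ht2 := ht.2
    refine ⟨?_, ?_⟩
    · simp only [Metric.mem_closedBall, dist_zero_right]
      have e : x = TT P (1 + t) x - t • (x - P x) := by unfold TT; module
      have : ‖x‖ ≤ ‖TT P (1 + t) x‖ + ‖t • (x - P x)‖ := by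
        conv_lhs => rw [e]
        exact norm_sub_le _ _
      rw [norm_smul, ← proj_infDist hP hP2, Real.norm_of_nonneg ht1.le] at this
      have := le_abs_self D
      nlinarith
    · simp only [mem_ofPred_eq]
      nlinarith
  set bound : E → ℝ := B.indicator fun x => w x * (C * Metric.infDist x K) with hbound
  have hbi : Integrable bound μ := by
    rw [hbound, integrable_indicator_iff hBc.measurableSet]
    refine ContinuousOn.integrableOn_compact hBc ?_
    intro x hx
    have hx0 : 0 < Metric.infDist x K := lt_of_lt_of_le (by positivity) hx.2
    apply ContinuousAt.continuousWithinAt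
    apply ContinuousAt.mul
    · exact ContinuousAt.comp (f := fun x => Metric.infDist x K)
        (wcont.continuousAt (Ioi_mem_nhds hx0))
        (Metric.continuous_infDist_pt K).continuousAt
    · have := (Metric.continuous_infDist_pt K).continuousAt (x := x)
      fun_prop
  have hbd : ∀ t ∈ Ioo (0:ℝ) 1, ∀ x, ‖w x * (t⁻¹ * (g (TT P (1 + t) x) - g x))‖ ≤ bound x := by
    intro t ht x
    by_cases hx : x ∈ B
    · simp only [hbound, indicator_of_mem hx]
      rw [norm_mul, Real.norm_of_nonneg (hw0 x), norm_mul, norm_inv, Real.norm_of_nonneg ht.1.le]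
      apply mul_le_mul_of_nonneg_left _ (hw0 x)
      have h := hC.dist_le_mul (TT P (1 + t) x) x
      have e : TT P (1 + t) x - x = t • (x - P x) := by unfold TT; module
      rw [dist_eq_norm, dist_eq_norm, e, norm_smul, ← proj_infDist hP hP2,
        Real.norm_of_nonneg ht.1.le] at h
      rw [inv_mul_le_iff₀ ht.1]
      linarith
    · have h1 : g x = 0 := image_eq_zero_of_notMem_tsupport fun h => hx (hsB h)
      have h2 : g (TT P (1 + t) x) = 0 :=
        image_eq_zero_of_notMem_tsupport fun h => hx (hTB t ht x h)
      simp [hbound, indicator_of_notMem hx, h1, h2]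
  have hmeas : ∀ t, AEStronglyMeasurable (fun x => w x * (t⁻¹ * (g (TT P (1 + t) x) - g x))) μ := by
    intro t
    apply hwm.aestronglyMeasurable.mul
    apply Continuous.aestronglyMeasurable
    have := hg.continuous
    unfold TT
    fun_prop
  have hev : ∀ᶠ t in nhdsWithin (0:ℝ) (Ioi 0), t ∈ Ioo (0:ℝ) 1 := Ioo_mem_nhdsGT one_pos
  have lim1 : Filter.Tendsto (fun t => ∫ x, w x * (t⁻¹ * (g (TT P (1 + t) x) - g x)) ∂μ)
      (nhdsWithin 0 (Ioi 0)) (nhds (∫ x, w x * fderiv ℝ g x (x - P x) ∂μ)) := by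
    refine tendsto_integral_filter_of_dominated_convergence bound
      (Filter.Eventually.of_forall hmeas) ?_ hbi (Filter.Eventually.of_forall fun x => ?_)
    · filter_upwards [hev] with t ht
      exact Filter.Eventually.of_forall (hbd t ht)
    · apply Filter.Tendsto.const_mul
      have h1 : HasDerivAt (fun t : ℝ => g (x + t • (x - P x))) (fderiv ℝ g x (x - P x)) 0 := by
        have h2 : HasFDerivAt g (fderiv ℝ g x) (x + (0:ℝ) • (x - P x)) := by
          simpa using (hg.differentiable one_ne_zero x).hasFDerivAt
        have h3 : HasDerivAt (fun t : ℝ => x + t • (x - P x)) (x - P x) 0 := by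
          simpa using ((hasDerivAt_id (0:ℝ)).smul_const (x - P x)).const_add x
        exact h2.comp_hasDerivAt 0 h3
      have h2 := h1.tendsto_slope_zero_right
      refine h2.congr fun t => ?_
      have e : TT P (1 + t) x = x + t • (x - P x) := by unfold TT; module
      simp [e]
  have lim2 : Filter.Tendsto (fun t : ℝ => (t⁻¹ * ((1 + t) ^ (-b) - 1)) * ∫ x, w x * g x ∂μ)
      (nhdsWithin 0 (Ioi 0)) (nhds (-b * ∫ x, w x * g x ∂μ)) := by
    apply Filter.Tendsto.mul_const
    have h1 : HasDerivAt (fun t : ℝ => (1 + t) ^ (-b)) (-b) 0 := by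
      have := ((hasDerivAt_id (0:ℝ)).const_add 1).rpow_const (p := -b) (Or.inl (by simp))
      simpa using this
    refine h1.tendsto_slope_zero_right.congr fun t => ?_
    simp
  have key := le_of_tendsto_of_tendsto lim1 lim2 ?_
  · linarith
  · filter_upwards [hev] with t ht
    have hs := step_ineq μ hcl V hV hP hP2 (p := p) hd hg.continuous hgc hgK hg0
      (l := 1 + t) (by linarith [ht.1])
    rw [← hm, ← hb] at hs
    have hDi : Integrable (fun x => w x * (t⁻¹ * (g (TT P (1 + t) x) - g x))) μ :=
      hbi.mono' (hmeas t) (Filter.Eventually.of_forall (hbd t ht))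
    have e : ∫ x, w x * g (TT P (1 + t) x) ∂μ = ∫ x, w x * g x ∂μ +
        t * ∫ x, w x * (t⁻¹ * (g (TT P (1 + t) x) - g x)) ∂μ := by
      rw [← integral_const_mul, ← integral_add hint (hDi.const_mul t)]
      congr 1
      ext x
      have := ht.1.ne'
      field_simp
      ring
    change ∫ x, w x * g (TT P (1 + t) x) ∂μ ≤ _ * ∫ x, w x * g x ∂μ at hs
    rw [e] at hs
    rw [mul_assoc, ← div_eq_inv_mul, le_div_iff₀ ht.1]
    linarith

theorem young {p a b : ℝ} (hp : 1 < p) (ha : 0 ≤ a) (hb : 0 ≤ b) :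
    p * a ^ (p - 1) * b ≤ (p - 1) * a ^ p + b ^ p := by
  have hpq : (p / (p - 1)).HolderConjugate p := by
    rw [Real.holderConjugate_comm, Real.holderConjugate_iff]
    refine ⟨hp, ?_⟩
    have : p - 1 ≠ 0 := by linarith
    have : p ≠ 0 := by linarith
    field_simp
    ring
  have h := Real.young_inequality_of_nonneg (Real.rpow_nonneg ha (p - 1)) hb hpq
  rw [← Real.rpow_mul ha] at h
  have h1 : p - 1 ≠ 0 := by linarith
  have h2 : p ≠ 0 := by linarith
  rw [show (p - 1) * (p / (p - 1)) = p by field_simp] at h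
  calc _ = p * (a ^ (p - 1) * b) := by ring
    _ ≤ p * (a ^ p / (p / (p - 1)) + b ^ p / p) := by gcongr
    _ = _ := by field_simp

theorem hardy_lower {K : Set E} (hcl : IsClosed K) (hne : K.Nonempty) (hc : Convex ℝ K)
    (V : Submodule ℝ E)
    (hV : ∀ x ∈ K, ∀ y ∈ K, x - y ∈ V)
    {δ δ' p b : ℝ} (hd : δ ≤ δ') (hp : 1 < p)
    (hb : b = (Module.finrank ℝ E - Module.finrank ℝ V : ℕ) + δ - p) (hb0 : 0 < b)
    {φ : E → ℝ} (hφ : ContDiff ℝ 1 φ) (hφc : HasCompactSupport φ) (hφK : tsupport φ ⊆ Kᶜ) :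
    (b / p) ^ p *
      ∫ x, cw δ δ' (Metric.infDist x K) * Metric.infDist x K ^ (-p) * |φ x| ^ p ∂μ ≤
     ∫ x, cw δ δ' (Metric.infDist x K) * ‖fderiv ℝ φ x‖ ^ p ∂μ := by
  obtain ⟨P, hP, hP2⟩ := exists_proj hne hcl hc
  set g : E → ℝ := fun x => |φ x| ^ p with hgdef
  have hg : ContDiff ℝ 1 g := by
    have := (contDiff_norm_rpow (E := ℝ) hp).comp hφ
    exact this
  have hz : ∀ x, φ x = 0 → g x = 0 := fun x hx => by
    simp [hgdef, hx, Real.zero_rpow (show p ≠ 0 by linarith)]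
  have hsupp : Function.support g ⊆ Function.support φ := fun x hx h => hx (hz x h)
  have hts : tsupport g ⊆ tsupport φ := closure_mono hsupp
  have hgc : HasCompactSupport g := hφc.mono hsupp
  have hkey := deriv_ineq μ hcl V hV hP hP2 (p := p) hd hg hgc (hts.trans hφK)
    (fun x => by positivity)
  rw [← hb] at hkey
  have hint := int_mul μ hcl hne (wcont (δ := δ) (δ' := δ') (p := p)) hg.continuous hgc
    (hts.trans hφK)
  have hint2 : Integrable (fun x => cw δ δ' (Metric.infDist x K) * ‖fderiv ℝ φ x‖ ^ p) μ := by
    have hcf := hφ.continuous_fderiv one_ne_zero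
    have hs : Function.support (fun x => ‖fderiv ℝ φ x‖ ^ p) ⊆ tsupport φ := by
      intro x hx
      by_contra h
      apply hx
      have : fderiv ℝ φ x = 0 := image_eq_zero_of_notMem_tsupport
        fun h' => h (tsupport_fderiv_subset ℝ h')
      simp [this, Real.zero_rpow (show p ≠ 0 by linarith)]
    refine int_mul μ hcl hne cw_cont ?_ ?_ ?_
    · exact Continuous.rpow_const (by fun_prop) fun x => Or.inr (by linarith)
    · exact HasCompactSupport.of_support_subset_isCompact hφc hs
    · exact (closure_minimal hs (isClosed_tsupport φ)).trans hφK
  set β := b / p with hβ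
  have hβ0 : 0 < β := by positivity
  have hpw : ∀ x, - (β ^ (p - 1) * (cw δ δ' (Metric.infDist x K) * Metric.infDist x K ^ (-p) *
      fderiv ℝ g x (x - P x))) ≤ (p - 1) * β ^ p *
      (cw δ δ' (Metric.infDist x K) * Metric.infDist x K ^ (-p) * g x) +
      cw δ δ' (Metric.infDist x K) * ‖fderiv ℝ φ x‖ ^ p := by
    intro x
    have hs0 := Metric.infDist_nonneg (x := x) (s := K)
    have hc0 := cw_nonneg (δ := δ) (δ' := δ') hs0
    have hs1 := proj_infDist hP hP2 x
    have hfd : fderiv ℝ g x = (p * |φ x| ^ (p - 2) * φ x) • fderiv ℝ φ x :=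
      ((hasDerivAt_abs_rpow (φ x) hp).comp_hasFDerivAt x
        (hφ.differentiable one_ne_zero x).hasFDerivAt).fderiv
    by_cases hx : φ x = 0
    · rw [hfd, hx]
      simp only [hz x hx, mul_zero, zero_smul]
      simp only [ContinuousLinearMap.zero_apply]
      have : 0 ≤ cw δ δ' (Metric.infDist x K) * ‖fderiv ℝ φ x‖ ^ p := by positivity
      simpa using this
    have hsp : 0 < Metric.infDist x K := (hcl.notMem_iff_infDist_pos hne).1
      (hφK (subset_tsupport _ hx))
    set s := Metric.infDist x K with hs
    have hb1 : - fderiv ℝ g x (x - P x) ≤ p * |φ x| ^ (p - 1) * (s * ‖fderiv ℝ φ x‖) := by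
      refine (neg_le_abs _).trans ?_
      rw [hfd, ContinuousLinearMap.smul_apply, smul_eq_mul, abs_mul, abs_mul, abs_mul,
        abs_of_nonneg (by linarith : 0 ≤ p), abs_of_nonneg (by positivity : 0 ≤ |φ x| ^ (p - 2)),
        mul_assoc p, ← Real.rpow_add_one (abs_ne_zero.2 hx)]
      have h1 := (fderiv ℝ φ x).le_opNorm (x - P x)
      rw [← hs1, Real.norm_eq_abs] at h1
      rw [show p - 2 + 1 = p - 1 by ring]
      gcongr
      linarith
    have hy := young hp (a := β * |φ x|) (b := s * ‖fderiv ℝ φ x‖) (by positivity) (by positivity)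
    rw [Real.mul_rpow hβ0.le (abs_nonneg _), Real.mul_rpow hβ0.le (abs_nonneg _),
      Real.mul_rpow hs0 (norm_nonneg _)] at hy
    have h3 : s ^ (-p) * s ^ p = 1 := by
      rw [← Real.rpow_add hsp]; simp
    calc _ = (cw δ δ' s * s ^ (-p) * β ^ (p - 1)) * (- fderiv ℝ g x (x - P x)) := by ring
      _ ≤ (cw δ δ' s * s ^ (-p) * β ^ (p - 1)) * (p * |φ x| ^ (p - 1) * (s * ‖fderiv ℝ φ x‖)) := by
        gcongr
      _ = (cw δ δ' s * s ^ (-p)) *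
          (p * (β ^ (p - 1) * |φ x| ^ (p - 1)) * (s * ‖fderiv ℝ φ x‖)) := by ring
      _ ≤ (cw δ δ' s * s ^ (-p)) * ((p - 1) * (β ^ p * |φ x| ^ p) + s ^ p * ‖fderiv ℝ φ x‖ ^ p) := by
        gcongr
      _ = (p - 1) * β ^ p * (cw δ δ' s * s ^ (-p) * g x) +
          (s ^ (-p) * s ^ p) * (cw δ δ' s * ‖fderiv ℝ φ x‖ ^ p) := by simp only [hgdef]; ring
      _ = _ := by rw [h3, one_mul]
  have hint3 : Integrable (fun x => cw δ δ' (Metric.infDist x K) * Metric.infDist x K ^ (-p) *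
      fderiv ℝ g x (x - P x)) μ := by
    have hPc := proj_lip hP hP2
    have hcf := hg.continuous_fderiv one_ne_zero
    have hs : Function.support (fun x => fderiv ℝ g x (x - P x)) ⊆ tsupport φ := by
      intro x hx
      by_contra h
      apply hx
      have : fderiv ℝ g x = 0 := image_eq_zero_of_notMem_tsupport
        fun h' => h (hts (tsupport_fderiv_subset ℝ h'))
      simp [this]
    refine int_mul μ hcl hne wcont ?_ ?_ ?_
    · fun_prop
    · exact HasCompactSupport.of_support_subset_isCompact hφc hs
    · exact (closure_minimal hs (isClosed_tsupport φ)).trans hφK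
  have hfin := integral_mono (hint3.const_mul _).neg ((hint.const_mul _).add hint2) hpw
  simp only [Pi.add_apply, Pi.neg_apply] at hfin
  rw [integral_neg, integral_add (hint.const_mul _) hint2, integral_const_mul,
    integral_const_mul] at hfin
  have h5 := mul_le_mul_of_nonneg_left hkey (Real.rpow_nonneg hβ0.le (p - 1))
  have h6 : β ^ (p - 1) * b = p * β ^ p := by
    have : b = p * β := by rw [hβ]; field_simp
    rw [this, Real.rpow_sub_one hβ0.ne']
    field_simp
  rw [← mul_assoc, h6] at h5
  linarith

end Lower

section Upper

variable {E : Type*} [NormedAddCommGroup E] [InnerProductSpace ℝ E] [FiniteDimensional ℝ E]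

theorem local_flat {K : Set E} (hne : K.Nonempty) (hc : Convex ℝ K) :
    ∃ x0 ∈ K, ∃ r : ℝ, 0 < r ∧ r ≤ 1 ∧ ∀ x ∈ Metric.ball x0 r,
      Metric.infDist x K = ‖(affineSpan ℝ K).directionᗮ.starProjection (x - x0)‖ := by
  obtain ⟨x0, hx0⟩ := Set.Nonempty.intrinsicInterior hc hne
  have hx0K : x0 ∈ K := intrinsicInterior_subset hx0
  obtain ⟨y, hy, hyx⟩ := mem_intrinsicInterior.1 hx0
  rw [mem_interior_iff_mem_nhds, Metric.mem_nhds_iff] at hy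
  obtain ⟨r, hr, hrs⟩ := hy
  refine ⟨x0, hx0K, min r 1, by positivity, min_le_right _ _, fun x hx => ?_⟩
  set V := (affineSpan ℝ K).direction with hV
  have hx' : dist x x0 < r := lt_of_lt_of_le hx (min_le_left _ _)
  have hdec : V.starProjection (x - x0) + Vᗮ.starProjection (x - x0) = x - x0 :=
    V.starProjection_add_starProjection_orthogonal _
  apply le_antisymm
  · have hmem : V.starProjection (x - x0) + x0 ∈ affineSpan ℝ K :=
      AffineSubspace.vadd_mem_of_mem_direction (V.starProjection_apply_mem _)
        (subset_affineSpan ℝ K hx0K)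
    have hK : V.starProjection (x - x0) + x0 ∈ K := by
      have : (⟨_, hmem⟩ : affineSpan ℝ K) ∈ Metric.ball y r := by
        rw [Metric.mem_ball, Subtype.dist_eq, hyx, dist_eq_norm, add_sub_cancel_right]
        refine (V.norm_starProjection_apply_le _).trans_lt ?_
        rwa [← dist_eq_norm]
      exact hrs this
    refine (Metric.infDist_le_dist_of_mem hK).trans (le_of_eq ?_)
    rw [dist_eq_norm]
    congr 1
    rw [sub_add_eq_sub_sub_swap]
    nth_rewrite 1 [← hdec]
    simp
  · rw [Metric.le_infDist hne]
    intro w hw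
    have hwV : w - x0 ∈ V := AffineSubspace.vsub_mem_direction
      (subset_affineSpan ℝ K hw) (subset_affineSpan ℝ K hx0K)
    have : Vᗮ.starProjection (x - x0) = Vᗮ.starProjection (x - w) := by
      have e : x - x0 = (x - w) + (w - x0) := by abel
      rw [e, map_add, V.starProjection_orthogonal_apply_eq_zero hwV, add_zero]
    rw [this, dist_eq_norm]
    exact Vᗮ.norm_starProjection_apply_le _

/-- dyadic shells -/
def Sh (V : Submodule ℝ E) (x0 : E) (a : ℝ) (j : ℕ) : Set E :=
  {x | ‖V.starProjection (x - x0)‖ < a ∧ a * (2:ℝ)⁻¹ ^ (j + 1) ≤ ‖Vᗮ.starProjection (x - x0)‖ ∧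
    ‖Vᗮ.starProjection (x - x0)‖ < a * (2:ℝ)⁻¹ ^ j}

theorem Sh_disj (V : Submodule ℝ E) (x0 : E) {a : ℝ} (ha : 0 < a) {i j : ℕ} {x : E}
    (hi : x ∈ Sh V x0 a i) (hj : x ∈ Sh V x0 a j) : i = j := by
  have key : ∀ i j : ℕ, x ∈ Sh V x0 a i → x ∈ Sh V x0 a j → i ≤ j := by
    intro i j hi hj
    have h := hj.2.1.trans_lt hi.2.2
    rw [mul_lt_mul_iff_right₀ ha, pow_lt_pow_iff_right_of_lt_one₀ (by norm_num) (by norm_num)] at h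
    omega
  exact le_antisymm (key i j hi hj) (key j i hj hi)

theorem Sh_exists (V : Submodule ℝ E) (x0 : E) {a : ℝ} (ha : 0 < a) {n : ℕ} {x : E}
    (hx : ‖V.starProjection (x - x0)‖ < a) (h1 : a * (2:ℝ)⁻¹ ^ n ≤ ‖Vᗮ.starProjection (x - x0)‖)
    (h2 : ‖Vᗮ.starProjection (x - x0)‖ < a) : ∃ j < n, x ∈ Sh V x0 a j := by
  induction n with
  | zero => rw [pow_zero, mul_one] at h1; linarith
  | succ n ih =>
    by_cases h : a * (2:ℝ)⁻¹ ^ n ≤ ‖Vᗮ.starProjection (x - x0)‖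
    · obtain ⟨j, hj, hjx⟩ := ih h
      exact ⟨j, by omega, hjx⟩
    · exact ⟨n, by omega, hx, h1, not_le.1 h⟩

variable [MeasurableSpace E] [BorelSpace E] (μ : Measure E) [μ.IsAddHaarMeasure]

theorem Sh_meas (V : Submodule ℝ E) (x0 : E) (a : ℝ) (j : ℕ) : MeasurableSet (Sh V x0 a j) := by
  have h1 : Continuous fun x => ‖V.starProjection (x - x0)‖ := by fun_prop
  have h2 : Continuous fun x => ‖Vᗮ.starProjection (x - x0)‖ := by fun_prop
  exact (measurableSet_lt h1.measurable measurable_const).inter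
    ((measurableSet_le measurable_const h2.measurable).inter
      (measurableSet_lt h2.measurable measurable_const))

theorem Sh_subset_ball (V : Submodule ℝ E) (x0 : E) {a : ℝ} (ha : 0 < a) (j : ℕ) :
    Sh V x0 a j ⊆ Metric.ball x0 (2 * a) := by
  intro x hx
  rw [Metric.mem_ball, dist_eq_norm, ← V.starProjection_add_starProjection_orthogonal (x - x0)]
  have h3 : ‖Vᗮ.starProjection (x - x0)‖ < a := by
    refine hx.2.2.trans_le ?_
    have : (2:ℝ)⁻¹ ^ j ≤ 1 := pow_le_one₀ (by norm_num) (by norm_num)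
    nlinarith
  have := norm_add_le (V.starProjection (x - x0)) (Vᗮ.starProjection (x - x0))
  have := hx.1
  linarith

theorem Sh_fin (V : Submodule ℝ E) (x0 : E) {a : ℝ} (ha : 0 < a) (j : ℕ) :
    μ (Sh V x0 a j) ≠ ⊤ :=
  ((measure_mono (Sh_subset_ball V x0 ha j)).trans_lt measure_ball_lt_top).ne

theorem Sh_vol (V : Submodule ℝ E) (x0 : E) (a : ℝ) (j : ℕ) :
    μ.real (Sh V x0 a j) =
      ((2:ℝ)⁻¹ ^ j) ^ (Module.finrank ℝ E - Module.finrank ℝ V) * μ.real (Sh V x0 a 0) := by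
  have e : ∀ i, Sh V x0 a i = (fun x => x + (-x0)) ⁻¹' Sh V 0 a i := by
    intro i
    ext x
    simp [Sh, sub_eq_add_neg]
  have hl : (0:ℝ) < 2⁻¹ ^ j := by positivity
  have e2 : Sh V 0 a j = LL V (2⁻¹ ^ j) '' Sh V 0 a 0 := by
    have hinv : ∀ l m : ℝ, l * m = 1 → ∀ x, LL V l (LL V m x) = x := by
      intro l m hlm x
      have h1 : V.starProjection (V.starProjection x) = V.starProjection x :=
        V.starProjection_eq_self_iff.2 (V.starProjection_apply_mem _)
      have h2 : Vᗮ.starProjection (Vᗮ.starProjection x) = Vᗮ.starProjection x :=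
        Vᗮ.starProjection_eq_self_iff.2 (Vᗮ.starProjection_apply_mem _)
      have h3 : V.starProjection (Vᗮ.starProjection x) = 0 :=
        V.starProjection_apply_eq_zero_iff.2 (Vᗮ.starProjection_apply_mem _)
      have h4 : Vᗮ.starProjection (V.starProjection x) = 0 :=
        V.starProjection_orthogonal_apply_eq_zero (V.starProjection_apply_mem _)
      simp only [LL_apply, map_add, map_smul, h1, h2, h3, h4, smul_add, smul_smul, mul_comm m l, hlm]
      simp
    rw [image_eq_preimage_of_inverse (g := LL V (2⁻¹ ^ j)⁻¹)
      (hinv _ _ (inv_mul_cancel₀ hl.ne')) (hinv _ _ (mul_inv_cancel₀ hl.ne'))]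
    ext x
    have h1 : V.starProjection (LL V (2⁻¹ ^ j)⁻¹ x) = V.starProjection x := by
      rw [LL_apply, map_add, map_smul, V.starProjection_eq_self_iff.2 (V.starProjection_apply_mem _),
        V.starProjection_apply_eq_zero_iff.2 (Vᗮ.starProjection_apply_mem _)]
      simp
    have h2 : Vᗮ.starProjection (LL V (2⁻¹ ^ j)⁻¹ x) = ((2:ℝ)⁻¹ ^ j)⁻¹ • Vᗮ.starProjection x := by
      rw [LL_apply, map_add, map_smul,
        Vᗮ.starProjection_eq_self_iff.2 (Vᗮ.starProjection_apply_mem _),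
        V.starProjection_orthogonal_apply_eq_zero (V.starProjection_apply_mem _), zero_add]
    simp only [Sh, mem_ofPred_eq, mem_preimage, sub_zero, h1, h2, norm_smul, norm_inv,
      Real.norm_of_nonneg hl.le]
    rw [← div_eq_inv_mul, le_div_iff₀ hl, div_lt_iff₀ hl]
    simp only [zero_add, pow_zero, pow_succ, pow_one, mul_one]
    constructor
    · rintro ⟨h1, h2, h3⟩
      exact ⟨h1, by linarith, by linarith⟩
    · rintro ⟨h1, h2, h3⟩
      exact ⟨h1, by linarith, by linarith⟩
  simp only [Measure.real]
  rw [e, e, measure_preimage_add_right, measure_preimage_add_right, e2,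
    Measure.addHaar_image_linearMap, LL_det, ENNReal.toReal_mul, ENNReal.toReal_ofReal (abs_nonneg _),
    abs_of_nonneg (by positivity)]

theorem Sh_pos (V : Submodule ℝ E) (hV : V ≠ ⊤) (x0 : E) {a : ℝ} (ha : 0 < a) :
    0 < μ.real (Sh V x0 a 0) := by
  refine ENNReal.toReal_pos ?_ (Sh_fin μ V x0 ha 0)
  have h1 : Continuous fun x => ‖V.starProjection (x - x0)‖ := by fun_prop
  have h2 : Continuous fun x => ‖Vᗮ.starProjection (x - x0)‖ := by fun_prop
  set U : Set E := {x | ‖V.starProjection (x - x0)‖ < a} ∩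
    ({x | a * 2⁻¹ < ‖Vᗮ.starProjection (x - x0)‖} ∩ {x | ‖Vᗮ.starProjection (x - x0)‖ < a}) with hU
  have hUo : IsOpen U := (isOpen_lt h1 continuous_const).inter
    ((isOpen_lt continuous_const h2).inter (isOpen_lt h2 continuous_const))
  have hUS : U ⊆ Sh V x0 a 0 := by
    rintro x ⟨h1, h2, h3⟩
    simp only [mem_ofPred_eq] at h1 h2 h3
    refine ⟨h1, ?_, ?_⟩
    · simpa using h2.le
    · simpa using h3
  have hUn : U.Nonempty := by
    have : Vᗮ ≠ ⊥ := fun h => hV ((Submodule.orthogonal_eq_bot_iff).1 h)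
    obtain ⟨v, hv, hv0⟩ := Submodule.exists_mem_ne_zero_of_ne_bot this
    have hvn : 0 < ‖v‖ := norm_pos_iff.2 hv0
    refine ⟨x0 + (a * (3/4) / ‖v‖) • v, ?_⟩
    have e1 : Vᗮ.starProjection v = v := Vᗮ.starProjection_eq_self_iff.2 hv
    have e2 : V.starProjection v = 0 := V.starProjection_apply_eq_zero_iff.2 hv
    have e3 : ‖(a * (3/4) / ‖v‖) • v‖ = a * (3/4) := by
      rw [norm_smul, Real.norm_of_nonneg (by positivity)]
      field_simp
    simp only [hU, mem_inter_iff, mem_ofPred_eq, add_sub_cancel_left, map_smul, e1, e2, e3]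
    refine ⟨by simpa using ha, by linarith, by linarith⟩
  exact fun h => (hUo.measure_pos μ hUn).ne' (measure_mono_null hUS h)

/-- integral of a step function on the shells -/
theorem Sh_int (V : Submodule ℝ E) (x0 : E) {a : ℝ} (ha : 0 < a) (n : ℕ) (k : ℕ → ℝ) :
    Integrable (fun x => ∑ j ∈ Finset.range n, (Sh V x0 a j).indicator (fun _ => k j) x) μ ∧
    ∫ x, ∑ j ∈ Finset.range n, (Sh V x0 a j).indicator (fun _ => k j) x ∂μ =
      ∑ j ∈ Finset.range n, k j *
      (((2:ℝ)⁻¹ ^ j) ^ (Module.finrank ℝ E - Module.finrank ℝ V) * μ.real (Sh V x0 a 0)) := by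
  have h : ∀ j, Integrable ((Sh V x0 a j).indicator (fun _ => k j)) μ := fun j =>
    (integrableOn_const (Sh_fin μ V x0 ha j)).integrable_indicator (Sh_meas V x0 a j)
  refine ⟨integrable_finsetSum _ fun j _ => h j, ?_⟩
  rw [integral_finsetSum _ fun j _ => h j]
  refine Finset.sum_congr rfl fun j _ => ?_
  rw [integral_indicator (Sh_meas V x0 a j), setIntegral_const, Sh_vol, smul_eq_mul, mul_comm]

theorem Sh_sum_le (V : Submodule ℝ E) (x0 : E) {a : ℝ} (ha : 0 < a) (n : ℕ) (k : ℕ → ℝ) {y : ℝ}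
    (x : E) (hy : 0 ≤ y) (h : ∀ j < n, x ∈ Sh V x0 a j → k j ≤ y) :
    ∑ j ∈ Finset.range n, (Sh V x0 a j).indicator (fun _ => k j) x ≤ y := by
  by_cases hx : ∃ j < n, x ∈ Sh V x0 a j
  · obtain ⟨j, hj, hjx⟩ := hx
    rw [Finset.sum_eq_single j]
    · rw [indicator_of_mem hjx]; exact h j hj hjx
    · intro i _ hij
      exact indicator_of_notMem (fun hi => hij (Sh_disj V x0 ha hi hjx)) _
    · intro hj'; simp at hj'; omega
  · push Not at hx
    rw [Finset.sum_eq_zero]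
    · exact hy
    · intro j hj
      exact indicator_of_notMem (hx j (Finset.mem_range.1 hj)) _

theorem le_Sh_sum (V : Submodule ℝ E) (x0 : E) {a : ℝ} {n : ℕ} {k : ℕ → ℝ} {y : ℝ}
    {x : E} (hk : ∀ j, 0 ≤ k j) {j : ℕ} (hj : j < n) (hjx : x ∈ Sh V x0 a j) (h : y ≤ k j) :
    y ≤ ∑ j ∈ Finset.range n, (Sh V x0 a j).indicator (fun _ => k j) x := by
  refine h.trans ?_
  have := Finset.single_le_sum (f := fun j => (Sh V x0 a j).indicator (fun _ => k j) x)
    (fun i _ => indicator_nonneg (fun _ _ => hk i) x) (Finset.mem_range.2 hj)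
  simpa [indicator_of_mem hjx] using this

theorem conv_ineq {p a b t : ℝ} (hp : 1 < p) (ha : 0 ≤ a) (hb : 0 ≤ b) (ht : 0 < t) (ht1 : t < 1) :
    (a + b) ^ p ≤ (1 - t) ^ (1 - p) * a ^ p + t ^ (1 - p) * b ^ p := by
  have h1 : 0 < 1 - t := by linarith
  have h := (convexOn_rpow hp.le).2 (x := a / (1 - t)) (y := b / t) (mem_Ici.2 (by positivity))
    (mem_Ici.2 (by positivity)) h1.le ht.le (by ring)
  simp only [smul_eq_mul] at h
  rw [mul_div_cancel₀ _ h1.ne', mul_div_cancel₀ _ ht.ne', Real.div_rpow ha h1.le,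
    Real.div_rpow hb ht.le] at h
  rw [Real.rpow_sub h1, Real.rpow_sub ht, Real.rpow_one, Real.rpow_one]
  refine h.trans (le_of_eq ?_)
  ring

end Upper

section Upper2

variable {E : Type*} [NormedAddCommGroup E] [InnerProductSpace ℝ E] [FiniteDimensional ℝ E]

theorem exists_psi (V : Submodule ℝ E) (x0 : E) {r : ℝ} (hr : 0 < r) :
    ∃ C : ℝ, 0 ≤ C ∧ ∀ n : ℕ, ∃ ψ : E → ℝ, ContDiff ℝ 1 ψ ∧ (∀ x, 0 ≤ ψ x) ∧
      tsupport ψ ⊆ Metric.closedBall x0 (r / 2) ∧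
      (∀ x, ‖Vᗮ.starProjection (x - x0)‖ < r * 2⁻¹ ^ n → ψ x = 0) ∧
      (∀ x ∈ Metric.ball x0 (r / 4), 2 * r * 2⁻¹ ^ n ≤ ‖Vᗮ.starProjection (x - x0)‖ → ψ x = 1) ∧
      (∀ x, 0 < ‖Vᗮ.starProjection (x - x0)‖ →
        ‖Vᗮ.starProjection (x - x0)‖ * ‖fderiv ℝ ψ x‖ ≤ C * (‖Vᗮ.starProjection (x - x0)‖ +
          r * 2⁻¹ ^ n / ‖Vᗮ.starProjection (x - x0)‖)) := by
  let χ : ContDiffBump x0 := ⟨r / 4, r / 2, by positivity, by linarith⟩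
  let f : ContDiffBump (0 : E) := ⟨1, 2, by norm_num, by norm_num⟩
  have hχd : ContDiff ℝ 1 χ := χ.contDiff
  have hfd : ContDiff ℝ 1 f := f.contDiff
  obtain ⟨C1, hC1⟩ := (χ.hasCompactSupport.fderiv ℝ).exists_bound_of_continuous
    (hχd.continuous_fderiv one_ne_zero)
  obtain ⟨C2, hC2⟩ := (f.hasCompactSupport.fderiv ℝ).exists_bound_of_continuous
    (hfd.continuous_fderiv one_ne_zero)
  have hC10 : 0 ≤ C1 := (norm_nonneg _).trans (hC1 0)
  have hC20 : 0 ≤ C2 := (norm_nonneg _).trans (hC2 0)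
  refine ⟨C1 + 4 * C2, by positivity, fun n => ?_⟩
  set Q := Vᗮ.starProjection with hQ
  set N : ℝ := (r * 2⁻¹ ^ n)⁻¹ with hN
  have hN0 : 0 < N := by positivity
  have hNi : r * 2⁻¹ ^ n = N⁻¹ := by rw [hN, inv_inv]
  let A : E → E := fun x => N • Q (x - x0)
  have hA : ContDiff ℝ 1 A := by
    have : ContDiff ℝ 1 (fun x : E => x - x0) := contDiff_id.sub contDiff_const
    exact (Q.contDiff.comp this).const_smul N
  have hAn : ∀ x, ‖A x‖ = N * ‖Q (x - x0)‖ := fun x => by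
    simp only [A, norm_smul, Real.norm_of_nonneg hN0.le]
  have hAd : ∀ x, ‖fderiv ℝ A x‖ ≤ N := by
    intro x
    have : LipschitzWith ⟨N, hN0.le⟩ A := by
      apply LipschitzWith.of_dist_le_mul
      intro x y
      have e : A x - A y = N • Q (x - y) := by
        simp only [A, ← smul_sub, ← map_sub]; congr 2; abel
      rw [dist_eq_norm, e, norm_smul, Real.norm_of_nonneg hN0.le, dist_eq_norm]
      exact mul_le_mul_of_nonneg_left (Vᗮ.norm_starProjection_apply_le _) hN0.le
    exact norm_fderiv_le_of_lipschitz ℝ this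
  let h : E → ℝ := fun x => 1 - f (A x)
  have hh : ContDiff ℝ 1 h := contDiff_const.sub (hfd.comp hA)
  have hh0 : ∀ x, 0 ≤ h x := fun x => by have := f.le_one (x := A x); simp only [h]; linarith
  have hh1 : ∀ x, h x ≤ 1 := fun x => by have := f.nonneg (x := A x); simp only [h]; linarith
  have hhd : ∀ x, 0 < ‖Q (x - x0)‖ →
      ‖Q (x - x0)‖ * ‖fderiv ℝ h x‖ ≤ 4 * C2 * (N⁻¹ / ‖Q (x - x0)‖) := by
    intro x hs
    by_cases hx : 2 < ‖A x‖
    · have : h =ᶠ[nhds x] fun _ => 1 := by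
        have h2 : ∀ᶠ y in nhds x, 2 < ‖A y‖ :=
          hA.continuous.norm.continuousAt.eventually (lt_mem_nhds hx)
        filter_upwards [h2] with y hy
        have : f (A y) = 0 := f.zero_of_le_dist (by rw [dist_zero_right]; exact hy.le)
        simp [h, this]
      rw [this.fderiv_eq]
      simp only [fderiv_fun_const, Pi.zero_apply, norm_zero, mul_zero]
      positivity
    · have h1 : ‖fderiv ℝ h x‖ ≤ C2 * N := by
        have : fderiv ℝ h x = - (fderiv ℝ f (A x)).comp (fderiv ℝ A x) := by
          have d1 : HasFDerivAt (fun x => f (A x)) _ x :=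
            ((hfd.differentiable one_ne_zero (A x)).hasFDerivAt.comp x
              (hA.differentiable one_ne_zero x).hasFDerivAt)
          exact (d1.const_sub 1).fderiv
        rw [this, norm_neg]
        refine (ContinuousLinearMap.opNorm_comp_le _ _).trans ?_
        exact mul_le_mul (hC2 _) (hAd _) (norm_nonneg _) hC20
      rw [hAn] at hx
      set s := ‖Q (x - x0)‖ with hs'
      have h2 : s * N ≤ 4 * (N⁻¹ / s) := by
        rw [← mul_div_assoc, le_div_iff₀ hs]
        have h3 : s * N * s * N ≤ 4 := by nlinarith [mul_pos hs hN0]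
        have h5 : (4:ℝ) * N⁻¹ = 4 / N := (div_eq_mul_inv 4 N).symm
        rw [h5, le_div_iff₀ hN0]
        exact h3
      calc s * ‖fderiv ℝ h x‖ ≤ s * (C2 * N) := by gcongr
        _ = C2 * (s * N) := by ring
        _ ≤ C2 * (4 * (N⁻¹ / s)) := by gcongr
        _ = _ := by ring
  refine ⟨fun x => χ x * h x, hχd.mul hh, fun x => mul_nonneg χ.nonneg (hh0 x), ?_, ?_, ?_, ?_⟩
  · have : tsupport χ = Metric.closedBall x0 (r / 2) := χ.tsupport_eq
    rw [← this]
    exact tsupport_mul_subset_left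
  · intro x hx
    have : f (A x) = 1 := by
      apply f.one_of_mem_closedBall
      rw [Metric.mem_closedBall, dist_zero_right, hAn]
      change N * _ ≤ 1
      rw [hNi] at hx
      calc _ ≤ N * N⁻¹ := by gcongr
        _ = 1 := mul_inv_cancel₀ hN0.ne'
    simp [h, this]
  · intro x hx hx2
    have e1 : χ x = 1 := χ.one_of_mem_closedBall (Metric.ball_subset_closedBall hx)
    have e2 : f (A x) = 0 := by
      apply f.zero_of_le_dist
      rw [dist_zero_right, hAn]
      change 2 ≤ _
      rw [mul_assoc, hNi] at hx2
      calc (2:ℝ) = N * (2 * N⁻¹) := by field_simp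
        _ ≤ _ := by gcongr
    simp [h, e1, e2]
  · intro x hs
    have d1 := ((hχd.differentiable one_ne_zero x).hasFDerivAt.mul
      (hh.differentiable one_ne_zero x).hasFDerivAt)
    have e : fderiv ℝ (fun x => χ x * h x) x = _ := d1.fderiv
    rw [e, hNi]
    have n1 : ‖χ x • fderiv ℝ h x + h x • fderiv ℝ χ x‖ ≤ ‖fderiv ℝ h x‖ + C1 := by
      refine (norm_add_le _ _).trans ?_
      rw [norm_smul, norm_smul, Real.norm_of_nonneg χ.nonneg, Real.norm_of_nonneg (hh0 x)]
      have := hC1 x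
      have := χ.le_one (x := x)
      have := hh1 x
      have := hh0 x
      have := χ.nonneg (x := x)
      have := norm_nonneg (fderiv ℝ h x)
      have := norm_nonneg (fderiv ℝ χ x)
      apply add_le_add <;> nlinarith
    have h3 := hhd x hs
    set s := ‖Q (x - x0)‖ with hs'
    have h4 : 0 ≤ N⁻¹ / s := by positivity
    calc _ ≤ s * (‖fderiv ℝ h x‖ + C1) := by gcongr
      _ = s * ‖fderiv ℝ h x‖ + C1 * s := by ring
      _ ≤ _ := by nlinarith

theorem phi_props (V : Submodule ℝ E) (x0 : E) {ε β : ℝ} (hε : 0 < ε) (hβ : 0 ≤ β) {ψ : E → ℝ}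
    (hψ : ContDiff ℝ 1 ψ) (hψ0 : ∀ x, 0 ≤ ψ x)
    (hψε : ∀ x, ‖Vᗮ.starProjection (x - x0)‖ < ε → ψ x = 0) :
    ContDiff ℝ 1 (fun x => ψ x * ‖Vᗮ.starProjection (x - x0)‖ ^ (-β)) ∧
    ∀ x, 0 < ‖Vᗮ.starProjection (x - x0)‖ →
      ‖fderiv ℝ (fun x => ψ x * ‖Vᗮ.starProjection (x - x0)‖ ^ (-β)) x‖ ≤
        β * (ψ x * ‖Vᗮ.starProjection (x - x0)‖ ^ (-β) * ‖Vᗮ.starProjection (x - x0)‖⁻¹) +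
        ‖Vᗮ.starProjection (x - x0)‖ ^ (-β) * ‖fderiv ℝ ψ x‖ := by
  set Q := Vᗮ.starProjection with hQ
  have hA : ContDiff ℝ 1 (fun x => Q (x - x0)) := by
    have : ContDiff ℝ 1 (fun x : E => x - x0) := contDiff_id.sub contDiff_const
    exact Q.contDiff.comp this
  constructor
  · rw [contDiff_iff_contDiffAt]
    intro x
    by_cases hx : ‖Q (x - x0)‖ < ε
    · have : (fun x => ψ x * ‖Q (x - x0)‖ ^ (-β)) =ᶠ[nhds x] fun _ => 0 := by
        filter_upwards [hA.continuous.norm.continuousAt.eventually (gt_mem_nhds hx)] with y hy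
        simp [hψε y hy]
      exact contDiffAt_const.congr_of_eventuallyEq this
    · have hp : 0 < ‖Q (x - x0)‖ := by linarith
      apply hψ.contDiffAt.mul
      exact ContDiffAt.rpow_const_of_ne (f := fun x => ‖Q (x - x0)‖)
        (hA.contDiffAt.norm ℝ (norm_pos_iff.1 hp)) hp.ne'
  · intro x hs
    have d0 : DifferentiableAt ℝ (fun x => ‖Q (x - x0)‖) x :=
      (hA.differentiable one_ne_zero x).norm ℝ (norm_pos_iff.1 hs)
    have n0 : ‖fderiv ℝ (fun x => ‖Q (x - x0)‖) x‖ ≤ 1 := by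
      have : LipschitzWith 1 (fun x => ‖Q (x - x0)‖) := by
        apply LipschitzWith.of_dist_le_mul
        intro x y
        rw [Real.dist_eq, NNReal.coe_one, one_mul, dist_eq_norm]
        refine (abs_norm_sub_norm_le _ _).trans ?_
        rw [← map_sub, sub_sub_sub_cancel_right]
        exact Vᗮ.norm_starProjection_apply_le _
      exact norm_fderiv_le_of_lipschitz ℝ this
    have d1 := d0.hasFDerivAt.rpow_const (p := -β) (Or.inl hs.ne')
    have d2 := (hψ.differentiable one_ne_zero x).hasFDerivAt.mul d1
    have e : fderiv ℝ (fun x => ψ x * ‖Q (x - x0)‖ ^ (-β)) x = _ := d2.fderiv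
    rw [e]
    set s := ‖Q (x - x0)‖ with hs'
    refine (norm_add_le _ _).trans ?_
    rw [norm_smul, norm_smul, norm_smul, Real.norm_of_nonneg (hψ0 x), norm_mul, norm_neg,
      Real.norm_of_nonneg hβ, Real.norm_of_nonneg (by positivity : 0 ≤ s ^ (-β - 1)),
      Real.norm_of_nonneg (by positivity : 0 ≤ s ^ (-β)), Real.rpow_sub_one hs.ne', div_eq_mul_inv]
    apply add_le_add _ le_rfl
    have := hψ0 x
    calc _ ≤ ψ x * (β * (s ^ (-β) * s⁻¹) * 1) := by gcongr
      _ = _ := by ring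

theorem W_eq {δ δ' p b m s : ℝ} (hb : b = m + δ - p) (hs : 0 < s) :
    cw δ δ' s * s ^ (-p) * s ^ (-b) = s ^ (-m) * (1 + s) ^ (δ' - δ) := by
  unfold cw
  have : s ^ δ * s ^ (-p) * s ^ (-b) = s ^ (-m) := by
    rw [← Real.rpow_add hs, ← Real.rpow_add hs]
    congr 1
    rw [hb]; ring
  rw [← this]; ring

theorem one_add_le {κ s : ℝ} (hs : 0 < s) (hs1 : s ≤ 1) :
    (1 + s) ^ κ ≤ 2 ^ |κ| ∧ (2 ^ |κ|)⁻¹ ≤ (1 + s) ^ κ := by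
  have h1 : (1 + s) ^ |κ| ≤ 2 ^ |κ| :=
    Real.rpow_le_rpow (by positivity) (by linarith) (abs_nonneg _)
  constructor
  · exact (Real.rpow_le_rpow_of_exponent_le (by linarith) (le_abs_self κ)).trans h1
  · calc (2 ^ |κ|)⁻¹ ≤ ((1 + s) ^ |κ|)⁻¹ := by gcongr
      _ = (1 + s) ^ (-|κ|) := by rw [Real.rpow_neg (by positivity)]
      _ ≤ _ := Real.rpow_le_rpow_of_exponent_le (by linarith) (neg_abs_le κ)

end Upper2

section Upper3

variable {E : Type*} [NormedAddCommGroup E] [InnerProductSpace ℝ E] [FiniteDimensional ℝ E]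
  [MeasurableSpace E] [BorelSpace E] (μ : Measure E) [μ.IsAddHaarMeasure]

theorem supp_ge (V : Submodule ℝ E) (x0 : E) {ε : ℝ} {ψ : E → ℝ}
    (hz : ∀ x, ‖Vᗮ.starProjection (x - x0)‖ < ε → ψ x = 0) {x : E} (hx : x ∈ tsupport ψ) :
    ε ≤ ‖Vᗮ.starProjection (x - x0)‖ := by
  have h2 : Continuous fun x => ‖Vᗮ.starProjection (x - x0)‖ := by fun_prop
  have hcl : IsClosed {x | ε ≤ ‖Vᗮ.starProjection (x - x0)‖} := isClosed_le continuous_const h2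
  refine closure_minimal ?_ hcl hx
  intro y hy
  by_contra h
  exact hy (hz y (not_le.1 h))

theorem sum_q (n : ℕ) : ∑ j ∈ Finset.range n, ((2:ℝ)⁻¹ ^ j + 2⁻¹ ^ n * 2 ^ j) ≤ 3 := by
  have h1 : ∀ n : ℕ, ∑ j ∈ Finset.range n, (2:ℝ)⁻¹ ^ j = 2 - 2 * 2⁻¹ ^ n := by
    intro n
    induction n with
    | zero => simp
    | succ n ih => rw [Finset.sum_range_succ, ih]; ring
  have h2 : ∀ n : ℕ, ∑ j ∈ Finset.range n, (2:ℝ) ^ j = 2 ^ n - 1 := by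
    intro n
    induction n with
    | zero => simp
    | succ n ih => rw [Finset.sum_range_succ, ih]; ring
  have h3 : (2:ℝ)⁻¹ ^ n * 2 ^ n = 1 := by rw [← mul_pow]; norm_num
  have h4 : (0:ℝ) < 2⁻¹ ^ n := by positivity
  rw [Finset.sum_add_distrib, ← Finset.mul_sum, h1, h2, mul_sub, h3]
  linarith

theorem err_bound {K : Set E} (V : Submodule ℝ E) (x0 : E) {r δ δ' p b C : ℝ} {m : ℕ}
    (hm : m = Module.finrank ℝ E - Module.finrank ℝ V)
    (hr : 0 < r) (hr1 : r ≤ 1) (hp : 1 < p) (hb : b = m + δ - p) (hC : 0 ≤ C)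
    (hflat : ∀ x ∈ Metric.ball x0 r, Metric.infDist x K = ‖Vᗮ.starProjection (x - x0)‖) :
    ∃ Ec : ℝ, 0 ≤ Ec ∧ ∀ (n : ℕ) (ψ : E → ℝ),
      tsupport ψ ⊆ Metric.closedBall x0 (r / 2) →
      (∀ x, ‖Vᗮ.starProjection (x - x0)‖ < r * 2⁻¹ ^ n → ψ x = 0) →
      (∀ x, 0 < ‖Vᗮ.starProjection (x - x0)‖ →
        ‖Vᗮ.starProjection (x - x0)‖ * ‖fderiv ℝ ψ x‖ ≤ C * (‖Vᗮ.starProjection (x - x0)‖ +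
          r * 2⁻¹ ^ n / ‖Vᗮ.starProjection (x - x0)‖)) →
      ∫ x, cw δ δ' (Metric.infDist x K) * Metric.infDist x K ^ (-b) * ‖fderiv ℝ ψ x‖ ^ p ∂μ
        ≤ Ec := by
  set c0 : ℝ := 2 ^ |δ' - δ| with hc0
  have hc0p : 0 < c0 := by positivity
  have hp0 : 0 < p := by linarith
  set M : ℝ := c0 * ((r * 2⁻¹) ^ m)⁻¹ * ((2 * C) ^ p * 2 ^ p) with hM
  have hM0 : 0 ≤ M := by positivity
  set σ := μ.real (Sh V x0 r 0) with hσ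
  have hσ0 : 0 ≤ σ := measureReal_nonneg
  refine ⟨M * σ * 3, by positivity, fun n ψ hsupp hz hgrad => ?_⟩
  set q : ℕ → ℝ := fun j => 2⁻¹ ^ j + 2⁻¹ ^ n * 2 ^ j with hq
  have hq0 : ∀ j, 0 < q j := fun j => by positivity
  set k : ℕ → ℝ := fun j => M * q j * ((2⁻¹ ^ j) ^ m)⁻¹ with hk
  have hk0 : ∀ j, 0 ≤ k j := fun j => by have := (hq0 j).le; positivity
  obtain ⟨hi, he⟩ := Sh_int μ V x0 hr n k
  calc _ ≤ ∫ x, ∑ j ∈ Finset.range n, (Sh V x0 r j).indicator (fun _ => k j) x ∂μ := by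
        apply integral_mono_of_nonneg _ hi
        · refine Filter.Eventually.of_forall fun x => ?_
          by_cases h0 : fderiv ℝ ψ x = 0
          · simp only [h0, norm_zero, Real.zero_rpow hp0.ne', mul_zero]
            exact Finset.sum_nonneg fun j _ => indicator_nonneg (fun _ _ => hk0 j) x
          · have hxs : x ∈ tsupport ψ := support_fderiv_subset ℝ h0
            have hxb : x ∈ Metric.ball x0 r :=
              Metric.closedBall_subset_ball (by linarith) (hsupp hxs)
            have hsε := supp_ge V x0 hz hxs
            have hε : 0 < r * 2⁻¹ ^ n := by positivity
            have hxn : ‖x - x0‖ < r := by rwa [← dist_eq_norm]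
            have hs2 : ‖Vᗮ.starProjection (x - x0)‖ < r :=
              (Vᗮ.norm_starProjection_apply_le _).trans_lt hxn
            obtain ⟨j, hj, hjx⟩ := Sh_exists V x0 hr
              ((V.norm_starProjection_apply_le _).trans_lt hxn) hsε hs2
            apply le_Sh_sum V x0 hk0 hj hjx
            have hg := hgrad x (hε.trans_le hsε)
            have hl := hjx.2.1
            have hu := hjx.2.2
            beta_reduce
            rw [hflat x hxb]
            set s := ‖Vᗮ.starProjection (x - x0)‖ with hs
            have hs0 : 0 < s := hε.trans_le hsε
            set N := ‖fderiv ℝ ψ x‖ with hN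
            have hN0 : 0 ≤ N := norm_nonneg _
            have hj0 : (0:ℝ) < 2⁻¹ ^ j := by positivity
            have hsN : s * N ≤ 2 * C * q j := by
              refine hg.trans ?_
              rw [mul_comm 2 C, mul_assoc]
              apply mul_le_mul_of_nonneg_left _ hC
              have e1 : r * 2⁻¹ ^ n / s ≤ 2 * (2⁻¹ ^ n * 2 ^ j) := by
                rw [div_le_iff₀ hs0]
                have e2 : (2:ℝ)⁻¹ ^ j * 2 ^ j = 1 := by rw [← mul_pow]; norm_num
                calc r * 2⁻¹ ^ n = 2 * (2⁻¹ ^ n * 2 ^ j) * (r * 2⁻¹ ^ (j + 1)) := by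
                      rw [pow_succ]
                      linear_combination (- r * 2⁻¹ ^ n) * e2
                  _ ≤ _ := by gcongr
              have e3 : s ≤ 2⁻¹ ^ j := by nlinarith
              simp only [hq]; linarith
            have hq2 : q j ≤ 2 := by
              have e1 : (2:ℝ)⁻¹ ^ j ≤ 1 := pow_le_one₀ (by norm_num) (by norm_num)
              have e2 : (2:ℝ)⁻¹ ^ n * 2 ^ j ≤ 1 := by
                have : (2:ℝ)⁻¹ ^ n ≤ 2⁻¹ ^ j :=
                  pow_le_pow_of_le_one (by norm_num) (by norm_num) hj.le
                calc _ ≤ (2:ℝ)⁻¹ ^ j * 2 ^ j := by gcongr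
                  _ = 1 := by rw [← mul_pow]; norm_num
              simp only [hq]; linarith
            have hsNp : (s * N) ^ p ≤ (2 * C) ^ p * 2 ^ p * q j := by
              calc (s * N) ^ p ≤ (2 * C * q j) ^ p :=
                    Real.rpow_le_rpow (by positivity) hsN hp0.le
                _ = (2 * C) ^ p * (2 * (q j / 2)) ^ p := by
                    rw [Real.mul_rpow (by positivity) (hq0 j).le, mul_div_cancel₀ _ two_ne_zero]
                _ = (2 * C) ^ p * 2 ^ p * (q j / 2) ^ p := by
                    rw [Real.mul_rpow (x := 2) (y := q j / 2) zero_le_two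
                      (by have := (hq0 j).le; positivity), mul_assoc ((2 * C) ^ p)]
                _ ≤ (2 * C) ^ p * 2 ^ p * q j := by
                    have h1 : (q j / 2) ^ p ≤ q j := by
                      have := Real.rpow_le_rpow_of_exponent_ge (by have := (hq0 j); positivity)
                        (by linarith : q j / 2 ≤ 1) hp.le
                      rw [Real.rpow_one] at this
                      have := hq0 j
                      linarith
                    gcongr
            have hW := W_eq (δ := δ) (δ' := δ') hb hs0
            have hsp : s ^ (-p) * s ^ p = 1 := by
              rw [← Real.rpow_add hs0]; simp
            have hone := (one_add_le (κ := δ' - δ) hs0 (by linarith)).1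
            have hsm : s ^ (-(m:ℝ)) ≤ ((r * 2⁻¹) ^ m)⁻¹ * ((2⁻¹ ^ j) ^ m)⁻¹ := by
              rw [Real.rpow_neg hs0.le, Real.rpow_natCast, ← mul_inv, ← mul_pow]
              apply inv_anti₀ (by positivity)
              apply pow_le_pow_left₀ (by positivity)
              refine le_of_eq_of_le ?_ hl
              rw [pow_succ]; ring
            calc cw δ δ' s * s ^ (-b) * N ^ p
                = (cw δ δ' s * s ^ (-p) * s ^ (-b)) * (s * N) ^ p := by
                  rw [Real.mul_rpow hs0.le hN0]
                  linear_combination (- cw δ δ' s * s ^ (-b) * N ^ p) * hsp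
              _ = s ^ (-(m:ℝ)) * (1 + s) ^ (δ' - δ) * (s * N) ^ p := by rw [hW]
              _ ≤ (((r * 2⁻¹) ^ m)⁻¹ * ((2⁻¹ ^ j) ^ m)⁻¹) * c0 * ((2 * C) ^ p * 2 ^ p * q j) := by
                  gcongr
              _ = k j := by simp only [hk, hM]; ring
        · refine Filter.Eventually.of_forall fun x => ?_
          have h1 := cw_nonneg (δ := δ) (δ' := δ') (Metric.infDist_nonneg (x := x) (s := K))
          have h2 : 0 ≤ Metric.infDist x K := Metric.infDist_nonneg
          positivity
    _ = ∑ j ∈ Finset.range n, M * σ * q j := by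
        rw [he]
        apply Finset.sum_congr rfl
        intro j _
        have hj0 : ((2:ℝ)⁻¹ ^ j) ^ m ≠ 0 := by positivity
        rw [← hm, ← hσ]
        simp only [hk]
        linear_combination (M * q j * σ) * inv_mul_cancel₀ hj0
    _ ≤ _ := by
        rw [← Finset.mul_sum]
        exact mul_le_mul_of_nonneg_left (sum_q n) (by positivity)

theorem den_bound {K : Set E} (V : Submodule ℝ E) (hV : V ≠ ⊤) (x0 : E) {r δ δ' p b β : ℝ} {m : ℕ}
    (hm : m = Module.finrank ℝ E - Module.finrank ℝ V)
    (hr : 0 < r) (hr1 : r ≤ 1) (hp : 1 < p) (hb : b = m + δ - p) (hβ : β * p = b)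
    (hflat : ∀ x ∈ Metric.ball x0 r, Metric.infDist x K = ‖Vᗮ.starProjection (x - x0)‖) :
    ∃ κ : ℝ, 0 < κ ∧ ∀ (n : ℕ) (ψ : E → ℝ),
      (∀ x ∈ Metric.ball x0 (r / 4), 2 * r * 2⁻¹ ^ (n + 4) ≤ ‖Vᗮ.starProjection (x - x0)‖ →
        ψ x = 1) →
      Integrable (fun x => cw δ δ' (Metric.infDist x K) * Metric.infDist x K ^ (-p) *
        |ψ x * ‖Vᗮ.starProjection (x - x0)‖ ^ (-β)| ^ p) μ →
      κ * n ≤ ∫ x, cw δ δ' (Metric.infDist x K) * Metric.infDist x K ^ (-p) *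
        |ψ x * ‖Vᗮ.starProjection (x - x0)‖ ^ (-β)| ^ p ∂μ := by
  set c0 : ℝ := 2 ^ |δ' - δ| with hc0
  have hc0p : 0 < c0 := by positivity
  have hp0 : 0 < p := by linarith
  set a := r / 8 with ha'
  have ha : 0 < a := by positivity
  set σ := μ.real (Sh V x0 a 0) with hσ
  have hσ0 : 0 < σ := Sh_pos μ V hV x0 ha
  refine ⟨c0⁻¹ * (a ^ m)⁻¹ * σ, by positivity, fun n ψ hψ hint => ?_⟩
  set k : ℕ → ℝ := fun j => c0⁻¹ * (a ^ m)⁻¹ * ((2⁻¹ ^ j) ^ m)⁻¹ with hk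
  obtain ⟨hi, he⟩ := Sh_int μ V x0 ha n k
  calc _ = ∫ x, ∑ j ∈ Finset.range n, (Sh V x0 a j).indicator (fun _ => k j) x ∂μ := by
        rw [he, ← hm, ← hσ]
        have : ∀ j ∈ Finset.range n, k j * ((2⁻¹ ^ j) ^ m * σ) = c0⁻¹ * (a ^ m)⁻¹ * σ := by
          intro j _
          have hj0 : ((2:ℝ)⁻¹ ^ j) ^ m ≠ 0 := by positivity
          simp only [hk]
          linear_combination (c0⁻¹ * (a ^ m)⁻¹ * σ) * inv_mul_cancel₀ hj0
        rw [Finset.sum_congr rfl this]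
        simp [mul_comm]
    _ ≤ _ := by
        apply integral_mono hi hint
        intro x
        apply Sh_sum_le V x0 ha
        · have h1 := cw_nonneg (δ := δ) (δ' := δ') (Metric.infDist_nonneg (x := x) (s := K))
          have h2 : 0 ≤ Metric.infDist x K := Metric.infDist_nonneg
          positivity
        · intro j hj hjx
          have hxb4 : x ∈ Metric.ball x0 (r / 4) := by
            have := Sh_subset_ball V x0 ha j hjx
            rwa [ha', show 2 * (r / 8) = r / 4 by ring] at this
          have hxb : x ∈ Metric.ball x0 r := Metric.ball_subset_ball (by linarith) hxb4
          have hl := hjx.2.1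
          have hu := hjx.2.2
          have h1 : ψ x = 1 := by
            apply hψ x hxb4
            refine le_trans ?_ hl
            have : (2:ℝ)⁻¹ ^ n ≤ 2⁻¹ ^ (j + 1) :=
              pow_le_pow_of_le_one (by norm_num) (by norm_num) hj
            calc 2 * r * 2⁻¹ ^ (n + 4) = a * 2⁻¹ ^ n := by rw [pow_add, ha']; ring
              _ ≤ _ := by gcongr
          beta_reduce
          rw [hflat x hxb, h1, one_mul]
          set s := ‖Vᗮ.starProjection (x - x0)‖ with hs
          have hs0 : 0 < s := lt_of_lt_of_le (by positivity) hl
          have hj1 : (2:ℝ)⁻¹ ^ j ≤ 1 := pow_le_one₀ (by norm_num) (by norm_num)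
          have hs1 : s ≤ 1 := by nlinarith
          rw [abs_of_nonneg (by positivity), ← Real.rpow_mul hs0.le, neg_mul, hβ, W_eq hb hs0]
          have hone := (one_add_le (κ := δ' - δ) hs0 hs1).2
          have hsm : (a ^ m)⁻¹ * ((2⁻¹ ^ j) ^ m)⁻¹ ≤ s ^ (-(m:ℝ)) := by
            rw [Real.rpow_neg hs0.le, Real.rpow_natCast, ← mul_inv, ← mul_pow]
            apply inv_anti₀ (by positivity)
            exact pow_le_pow_left₀ hs0.le hu.le _
          calc k j = ((a ^ m)⁻¹ * ((2⁻¹ ^ j) ^ m)⁻¹) * c0⁻¹ := by simp only [hk]; ring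
            _ ≤ _ := by gcongr

end Upper3

section Upper4

variable {E : Type*} [NormedAddCommGroup E] [InnerProductSpace ℝ E] [FiniteDimensional ℝ E]
  [MeasurableSpace E] [BorelSpace E] (μ : Measure E) [μ.IsAddHaarMeasure]

theorem int_den {K : Set E} (hcl : IsClosed K) (hne : K.Nonempty) {δ δ' p : ℝ} (hp : 1 < p)
    {φ : E → ℝ} (hφ : Continuous φ) (hφc : HasCompactSupport φ) (hφK : tsupport φ ⊆ Kᶜ) :
    Continuous (fun x => cw δ δ' (Metric.infDist x K) * Metric.infDist x K ^ (-p) * |φ x| ^ p) ∧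
    HasCompactSupport
      (fun x => cw δ δ' (Metric.infDist x K) * Metric.infDist x K ^ (-p) * |φ x| ^ p) ∧
    Integrable
      (fun x => cw δ δ' (Metric.infDist x K) * Metric.infDist x K ^ (-p) * |φ x| ^ p) μ := by
  have hz : Function.support (fun x => |φ x| ^ p) ⊆ Function.support φ := by
    intro x hx h
    apply hx
    simp [h, Real.zero_rpow (by linarith : p ≠ 0)]
  have h1 : Continuous (fun x => |φ x| ^ p) := hφ.abs.rpow_const fun x => Or.inr (by linarith)
  have h2 : HasCompactSupport (fun x => |φ x| ^ p) := hφc.mono hz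
  have h3 : tsupport (fun x => |φ x| ^ p) ⊆ Kᶜ := (closure_mono hz).trans hφK
  exact ⟨cts_mul hcl hne wcont h1 h3, h2.mul_left, int_mul μ hcl hne wcont h1 h2 h3⟩

theorem int_grad {K : Set E} (hcl : IsClosed K) (hne : K.Nonempty) {p : ℝ} (hp : 1 < p)
    {F : ℝ → ℝ} (hF : ContinuousOn F (Ioi 0))
    {φ : E → ℝ} (hφ : ContDiff ℝ 1 φ) (hφc : HasCompactSupport φ) (hφK : tsupport φ ⊆ Kᶜ) :
    Integrable (fun x => F (Metric.infDist x K) * ‖fderiv ℝ φ x‖ ^ p) μ := by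
  have hz : Function.support (fun x => ‖fderiv ℝ φ x‖ ^ p) ⊆ Function.support (fderiv ℝ φ) := by
    intro x hx h
    apply hx
    simp [h, Real.zero_rpow (by linarith : p ≠ 0)]
  have h1 : Continuous (fun x => ‖fderiv ℝ φ x‖ ^ p) :=
    (hφ.continuous_fderiv one_ne_zero).norm.rpow_const fun x => Or.inr (by linarith)
  have h2 : HasCompactSupport (fun x => ‖fderiv ℝ φ x‖ ^ p) := (hφc.fderiv ℝ).mono hz
  have h3 : tsupport (fun x => ‖fderiv ℝ φ x‖ ^ p) ⊆ Kᶜ :=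
    ((closure_mono hz).trans (tsupport_fderiv_subset ℝ)).trans hφK
  exact int_mul μ hcl hne hF h1 h2 h3

theorem upper_exists {K : Set E} (hcl : IsClosed K) (hne : K.Nonempty) (hc : Convex ℝ K)
    (hV : (affineSpan ℝ K).direction ≠ ⊤)
    {δ δ' p b : ℝ} (hp : 1 < p)
    (hb : b = (Module.finrank ℝ E - Module.finrank ℝ (affineSpan ℝ K).direction : ℕ) + δ - p)
    (hb0 : 0 < b) :
    ∃ κ Ec : ℝ, 0 < κ ∧ 0 ≤ Ec ∧ ∀ n : ℕ, ∃ φ : E → ℝ, ContDiff ℝ 1 φ ∧ HasCompactSupport φ ∧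
      tsupport φ ⊆ Kᶜ ∧
      κ * n ≤ ∫ x, cw δ δ' (Metric.infDist x K) * Metric.infDist x K ^ (-p) * |φ x| ^ p ∂μ ∧
      ∀ t : ℝ, 0 < t → t < 1 →
        ∫ x, cw δ δ' (Metric.infDist x K) * ‖fderiv ℝ φ x‖ ^ p ∂μ ≤
          (1 - t) ^ (1 - p) * (b / p) ^ p *
          (∫ x, cw δ δ' (Metric.infDist x K) * Metric.infDist x K ^ (-p) * |φ x| ^ p ∂μ) +
          t ^ (1 - p) * Ec := by
  obtain ⟨x0, hx0, r, hr, hr1, hflat⟩ := local_flat hne hc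
  set V := (affineSpan ℝ K).direction with hVdef
  have hp0 : 0 < p := by linarith
  have hβ : b / p * p = b := div_mul_cancel₀ _ hp0.ne'
  set β := b / p with hβd
  have hβ0 : 0 ≤ β := by positivity
  obtain ⟨C, hC, hψ⟩ := exists_psi V x0 hr
  obtain ⟨Ec, hEc, herr⟩ := err_bound μ V x0 rfl hr hr1 hp hb hC hflat (δ' := δ')
  obtain ⟨κ, hκ, hden⟩ := den_bound μ V hV x0 rfl hr hr1 hp hb hβ hflat (δ' := δ')
  refine ⟨κ, Ec, hκ, hEc, fun n => ?_⟩
  obtain ⟨ψ, hψ1, hψ0, hψs, hψz, hψone, hψg⟩ := hψ (n + 4)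
  have hε : 0 < r * (2:ℝ)⁻¹ ^ (n + 4) := by positivity
  obtain ⟨hφ1, hφd⟩ := phi_props V x0 hε hβ0 hψ1 hψ0 hψz
  have hφψ : tsupport (fun x => ψ x * ‖Vᗮ.starProjection (x - x0)‖ ^ (-β)) ⊆ tsupport ψ :=
    tsupport_mul_subset_left
  have hψc : HasCompactSupport ψ :=
    (isCompact_closedBall x0 (r / 2)).of_isClosed_subset (isClosed_tsupport ψ) hψs
  have hball : ∀ x ∈ tsupport ψ, x ∈ Metric.ball x0 r := fun x hx =>
    Metric.closedBall_subset_ball (by linarith) (hψs hx)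
  have hψK : tsupport ψ ⊆ Kᶜ := by
    intro x hx hxK
    have h1 := hflat x (hball x hx)
    rw [Metric.infDist_zero_of_mem hxK] at h1
    have := supp_ge V x0 hψz hx
    linarith
  have hφc : HasCompactSupport (fun x => ψ x * ‖Vᗮ.starProjection (x - x0)‖ ^ (-β)) :=
    hψc.mul_right
  have hφK := hφψ.trans hψK
  have hDint := (int_den μ hcl hne (δ := δ) (δ' := δ') hp hφ1.continuous hφc hφK).2.2
  refine ⟨_, hφ1, hφc, hφK, hden n ψ hψone hDint, fun t ht ht1 => ?_⟩
  have hE := herr (n + 4) ψ hψs hψz hψg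
  have hEint := int_grad μ hcl hne hp (wcont (δ := δ) (δ' := δ') (p := b)) hψ1 hψc hψK
  have hGint := int_grad μ hcl hne hp (cw_cont (δ := δ) (δ' := δ')) hφ1 hφc hφK
  have ht0 : 0 < 1 - t := by linarith
  refine le_trans ?_ (add_le_add le_rfl (mul_le_mul_of_nonneg_left hE (by positivity)))
  rw [← integral_const_mul, ← integral_const_mul, ← integral_add (hDint.const_mul _)
    (hEint.const_mul _)]
  apply integral_mono hGint ((hDint.const_mul _).add (hEint.const_mul _))
  intro x
  by_cases hx : x ∈ tsupport ψ
  · have hs0 := hε.trans_le (supp_ge V x0 hψz hx)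
    have hd := hφd x hs0
    simp only [Pi.add_apply]
    rw [hflat x (hball x hx)]
    set s := ‖Vᗮ.starProjection (x - x0)‖ with hs
    set N := ‖fderiv ℝ ψ x‖ with hN
    have hN0 : 0 ≤ N := norm_nonneg _
    have hψx := hψ0 x
    have hcw : 0 ≤ cw δ δ' s := cw_nonneg hs0.le
    have h1 := (Real.rpow_le_rpow (norm_nonneg _) hd hp0.le).trans
      (conv_ineq hp (by positivity) (by positivity) ht ht1)
    have e1 : (β * (ψ x * s ^ (-β) * s⁻¹)) ^ p = β ^ p * (s ^ (-p) * |ψ x * s ^ (-β)| ^ p) := by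
      rw [abs_of_nonneg (by positivity), Real.mul_rpow hβ0 (by positivity),
        Real.mul_rpow (by positivity) (by positivity), Real.inv_rpow hs0.le, Real.rpow_neg hs0.le p]
      ring
    have e2 : (s ^ (-β) * N) ^ p = s ^ (-b) * N ^ p := by
      rw [Real.mul_rpow (by positivity) hN0, ← Real.rpow_mul hs0.le, neg_mul, hβ]
    rw [e1, e2] at h1
    refine (mul_le_mul_of_nonneg_left h1 hcw).trans (le_of_eq ?_)
    ring
  · have h1 : fderiv ℝ (fun x => ψ x * ‖Vᗮ.starProjection (x - x0)‖ ^ (-β)) x = 0 := by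
      by_contra h
      exact hx (hφψ (support_fderiv_subset ℝ h))
    have h2 := cw_nonneg (δ := δ) (δ' := δ') (Metric.infDist_nonneg (x := x) (s := K))
    have h3 : 0 ≤ Metric.infDist x K := Metric.infDist_nonneg
    simp only [h1, norm_zero, Real.zero_rpow hp0.ne', mul_zero, Pi.add_apply]
    positivity

end Upper4

theorem mu_num {d : ℕ} {K : Set (EuclideanSpace ℝ (Fin d))} {δ δ' p : ℝ} (hp : 1 < p)
    {φ : EuclideanSpace ℝ (Fin d) → ℝ} (hφK : tsupport φ ⊆ Kᶜ) :
    (∫ x in Kᶜ, (Metric.infDist x K ^ δ * (1 + Metric.infDist x K) ^ (δ' - δ)) *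
            ‖gradient φ x‖ ^ p) =
    ∫ x, cw δ δ' (Metric.infDist x K) * ‖fderiv ℝ φ x‖ ^ p := by
  have e : ∀ x, ‖gradient φ x‖ = ‖fderiv ℝ φ x‖ := fun x => by
    unfold gradient; exact LinearIsometryEquiv.norm_map _ _
  simp only [e]
  apply setIntegral_eq_integral_of_forall_compl_eq_zero
  intro x hx
  have : fderiv ℝ φ x = 0 := by
    by_contra h
    exact hx (hφK (support_fderiv_subset ℝ h))
  rw [this, norm_zero, Real.zero_rpow (by linarith), mul_zero]

theorem mu_den {d : ℕ} {K : Set (EuclideanSpace ℝ (Fin d))} {δ δ' p : ℝ} (hp : 1 < p)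
    {φ : EuclideanSpace ℝ (Fin d) → ℝ} (hφK : tsupport φ ⊆ Kᶜ) :
    (∫ x in Kᶜ, (Metric.infDist x K ^ δ * (1 + Metric.infDist x K) ^ (δ' - δ)) *
            Metric.infDist x K ^ (-p) * |φ x| ^ p) =
    ∫ x, cw δ δ' (Metric.infDist x K) * Metric.infDist x K ^ (-p) * |φ x| ^ p := by
  apply setIntegral_eq_integral_of_forall_compl_eq_zero
  intro x hx
  have : φ x = 0 := by
    by_contra h
    exact hx (hφK (subset_tsupport _ h))
  rw [this, abs_zero, Real.zero_rpow (by linarith), mul_zero]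

theorem den_pos {d : ℕ} {K : Set (EuclideanSpace ℝ (Fin d))} (hcl : IsClosed K) (hne : K.Nonempty)
    {δ δ' p : ℝ} (hp : 1 < p)
    {φ : EuclideanSpace ℝ (Fin d) → ℝ} (hφ : Continuous φ) (hφc : HasCompactSupport φ)
    (hφK : tsupport φ ⊆ Kᶜ) (h0 : φ ≠ 0) :
    0 < ∫ x, cw δ δ' (Metric.infDist x K) * Metric.infDist x K ^ (-p) * |φ x| ^ p := by
  obtain ⟨h1, h2, -⟩ := int_den volume hcl hne (δ := δ) (δ' := δ') hp hφ hφc hφK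
  obtain ⟨x, hx⟩ := Function.ne_iff.1 h0
  have hx : φ x ≠ 0 := hx
  have hxK : 0 < Metric.infDist x K :=
    (hcl.notMem_iff_infDist_pos hne).1 (hφK (subset_tsupport _ hx))
  refine h1.integral_pos_of_hasCompactSupport_nonneg_nonzero h2 (fun y => ?_) (x := x) ?_
  · have h2 := cw_nonneg (δ := δ) (δ' := δ') (Metric.infDist_nonneg (x := y) (s := K))
    have h3 : 0 ≤ Metric.infDist y K := Metric.infDist_nonneg
    simp only [Pi.zero_apply]
    positivity
  · have := cw_pos (δ := δ) (δ' := δ') hxK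
    have := abs_pos.2 hx
    positivity

/-- Local upper bound on the optimal Hardy constant, and its optimality for `δ ≤ δ'`
(Theorem 4.2 of the paper). -/
theorem hardy_optimal_constant_local_bound
    (d k : ℕ) (hd : 1 ≤ d) (K : Set (EuclideanSpace ℝ (Fin d)))
    (hKne : K.Nonempty) (hKcl : IsClosed K) (hKconv : Convex ℝ K)
    (hKproper : K ≠ Set.univ)
    (hk : Module.finrank ℝ (affineSpan ℝ K).direction = k)
    (hk1 : 1 ≤ k) (hkd : k ≤ d - 1)
    (p δ δ' : ℝ) (hp : 1 < p) (hδ : 0 ≤ δ) (hδ' : 0 ≤ δ')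
    (hcond : 0 < (d : ℝ) - k + min δ δ' - p) :
    muP d p δ δ' K ≤ (((d : ℝ) - k + δ - p) / p) ^ p ∧
    (δ ≤ δ' → muP d p δ δ' K = (((d : ℝ) - k + δ - p) / p) ^ p) := by
  have hdk : k < d := by omega
  set V := (affineSpan ℝ K).direction with hV
  have hfin : Module.finrank ℝ (EuclideanSpace ℝ (Fin d)) = d := by simp
  set b : ℝ := (d : ℝ) - k + δ - p with hb
  have hb0 : 0 < b := by have := min_le_left δ δ'; simp only [hb]; linarith
  have hp0 : 0 < p := by linarith
  have hb' : b = (Module.finrank ℝ (EuclideanSpace ℝ (Fin d)) - Module.finrank ℝ V : ℕ)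
      + δ - p := by
    rw [hfin, hk, Nat.cast_sub hdk.le]
  have hVtop : V ≠ ⊤ := by
    intro h
    rw [h, finrank_top, hfin] at hk
    omega
  obtain ⟨κ, Ec, hκ, hEc, hU⟩ := upper_exists volume hKcl hKne hKconv hVtop (δ' := δ') hp hb' hb0
  have hbdd : ∀ φ : EuclideanSpace ℝ (Fin d) → ℝ,
      0 ≤ ∫ x, cw δ δ' (Metric.infDist x K) * ‖fderiv ℝ φ x‖ ^ p := fun φ => by
    refine integral_nonneg fun x => ?_
    have h2 := cw_nonneg (δ := δ) (δ' := δ') (Metric.infDist_nonneg (x := x) (s := K))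
    simp only [Pi.zero_apply]
    positivity
  have hne0 : ∀ (n : ℕ) (φ : EuclideanSpace ℝ (Fin d) → ℝ), 1 ≤ n →
      κ * n ≤ (∫ x, cw δ δ' (Metric.infDist x K) * Metric.infDist x K ^ (-p) * |φ x| ^ p) →
      φ ≠ 0 := by
    intro n φ hn h h0
    simp only [h0, Pi.zero_apply, abs_zero, Real.zero_rpow hp0.ne', mul_zero,
      integral_zero] at h
    have : (0:ℝ) < n := by exact_mod_cast hn
    have := mul_pos hκ this
    linarith
  have hup : muP d p δ δ' K ≤ (b / p) ^ p := by
    have key : ∀ t : ℝ, 0 < t → t < 1 → ∀ n : ℕ, 1 ≤ n →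
        muP d p δ δ' K ≤ (1 - t) ^ (1 - p) * (b / p) ^ p + t ^ (1 - p) * Ec / κ * (1 / (n : ℝ)) := by
      intro t ht ht1 n hn
      obtain ⟨φ, h1, h2, h3, h4, h5⟩ := hU n
      have hφ0 := hne0 n φ hn h4
      have hD := den_pos hKcl hKne (δ := δ) (δ' := δ') hp h1.continuous h2 h3 hφ0
      have h6 := h5 t ht ht1
      unfold muP
      refine le_trans (csInf_le ?_ ⟨φ, h1, h2, h3, hφ0, rfl⟩) ?_
      · refine ⟨0, ?_⟩
        rintro _ ⟨f, f1, f2, f3, f4, rfl⟩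
        rw [mu_num hp f3, mu_den hp f3]
        exact div_nonneg (hbdd f) (den_pos hKcl hKne hp f1.continuous f2 f3 f4).le
      · rw [mu_num hp h3, mu_den hp h3, div_le_iff₀ hD, add_mul]
        refine h6.trans (add_le_add le_rfl ?_)
        have hn0 : (0:ℝ) < n := by exact_mod_cast hn
        have hc : 0 ≤ t ^ (1 - p) * Ec := by positivity
        calc t ^ (1 - p) * Ec = t ^ (1 - p) * Ec / κ * (1 / (n : ℝ)) * (κ * n) := by
              field_simp
          _ ≤ _ := by gcongr
    have key2 : ∀ t : ℝ, 0 < t → t < 1 →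
        muP d p δ δ' K ≤ (1 - t) ^ (1 - p) * (b / p) ^ p := by
      intro t ht ht1
      have hlim : Filter.Tendsto (fun n : ℕ => (1 - t) ^ (1 - p) * (b / p) ^ p +
          t ^ (1 - p) * Ec / κ * (1 / (n : ℝ))) Filter.atTop
          (nhds ((1 - t) ^ (1 - p) * (b / p) ^ p + t ^ (1 - p) * Ec / κ * 0)) :=
        tendsto_const_nhds.add (tendsto_one_div_atTop_nhds_zero_nat.const_mul _)
      rw [mul_zero, add_zero] at hlim
      refine ge_of_tendsto hlim ?_
      filter_upwards [Filter.eventually_ge_atTop 1] with n hn using key t ht ht1 n hn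
    have hlim : Filter.Tendsto (fun t : ℝ => (1 - t) ^ (1 - p) * (b / p) ^ p)
        (nhdsWithin 0 (Ioi 0)) (nhds ((1 - 0) ^ (1 - p) * (b / p) ^ p)) := by
      apply Filter.Tendsto.mono_left _ nhdsWithin_le_nhds
      have : ContinuousAt (fun t : ℝ => (1 - t) ^ (1 - p) * (b / p) ^ p) 0 := by
        apply ContinuousAt.mul _ continuousAt_const
        exact ContinuousAt.rpow_const (by fun_prop) (Or.inl (by norm_num))
      exact this
    rw [sub_zero, Real.one_rpow, one_mul] at hlim
    refine ge_of_tendsto hlim ?_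
    filter_upwards [Ioo_mem_nhdsGT (zero_lt_one (α := ℝ))] with t ht using key2 t ht.1 ht.2
  refine ⟨hup, fun hdd => le_antisymm hup ?_⟩
  obtain ⟨φ, h1, h2, h3, h4, -⟩ := hU 1
  refine le_csInf ⟨_, φ, h1, h2, h3, hne0 1 φ le_rfl h4, rfl⟩ ?_
  rintro _ ⟨f, f1, f2, f3, f4, rfl⟩
  rw [mu_num hp f3, mu_den hp f3, le_div_iff₀ (den_pos hKcl hKne hp f1.continuous f2 f3 f4)]
  exact hardy_lower volume hKcl hKne hKconv V
    (fun x hx y hy => AffineSubspace.vsub_mem_direction (subset_affineSpan ℝ K hx)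
      (subset_affineSpan ℝ K hy)) hdd hp hb' hb0 f1 f2 f3
end
end

section
/- Let k ≥ 1 and let K ⊆ ℝ^k be a closed convex set with nonempty interior whose dimension at infinity satisfies k_∞ = k, i.e. liminf_{r→∞} log(vol_k(K ∩ B_r))/log r = k. Then for every p ∈ [1,∞), inf{ (∫_{ℝ^k} |∇η|^p)/(∫_{ℝ^k} |η|^p) : η ∈ C_c^∞(ℝ^k), η ≠ 0, supp η ⊆ interior(K) } = 0. -/
open MeasureTheory Set Filter

noncomputable section

lemma aux_transl {k : ℕ} (C : Set (EuclideanSpace ℝ (Fin k))) (hC : Convex ℝ C)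
    (hCm : MeasurableSet C) (r : ℝ) (hr : 0 < r) (hCr : C ⊆ Metric.ball 0 r)
    (s : ℝ) (hs : 0 < s) (u : EuclideanSpace ℝ (Fin k)) (hu : ‖u‖ ≤ s) :
    volume.real {x ∈ C | x + u ∉ C} ≤
      s / r * ((2 * r) ^ k * volume.real (Metric.ball (0 : EuclideanSpace ℝ (Fin k)) 1)) := by
  set A := {x ∈ C | x + u ∉ C} with hA
  have hAm : MeasurableSet A := by
    have : A = C \ ((fun x => x + u) ⁻¹' C) := by ext x; simp [hA]
    rw [this]
    exact hCm.diff (hCm.preimage (measurable_add_const u))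
  have hout : ∀ x ∈ A, ∀ j : ℕ, 1 ≤ j → x + (j : ℝ) • u ∉ C := by
    intro x hx j hj hmem
    apply hx.2
    have hj' : (1 : ℝ) ≤ j := by exact_mod_cast hj
    have := hC.add_smul_mem hx.1 hmem (t := 1 / (j : ℝ)) ⟨by positivity, by
      rw [div_le_one (by linarith)]; exact hj'⟩
    rwa [smul_smul, one_div, inv_mul_cancel₀ (by linarith), one_smul] at this
  set N := ⌊r / s⌋₊ with hN
  let T : ℕ → Set (EuclideanSpace ℝ (Fin k)) := fun j => (fun x => x + (j : ℝ) • (-u)) ⁻¹' A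
  have hTm : ∀ j, MeasurableSet (T j) := fun j => hAm.preimage (measurable_add_const _)
  have hTv : ∀ j, volume (T j) = volume A := fun j => measure_preimage_add_right _ _ _
  have key : ∀ i j : ℕ, i < j → Disjoint (T i) (T j) := by
    intro i j hij
    rw [Set.disjoint_left]
    intro x hx hx'
    refine hout _ hx' (j - i) (by omega) ?_
    have h1 := hx.1
    rw [Nat.cast_sub hij.le]
    convert h1 using 1
    module
  have hdisj : Pairwise (Function.onFun Disjoint T) := by
    intro i j hij
    rcases lt_or_gt_of_ne hij with h | h
    · exact key i j h
    · exact (key j i h).symm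
  have hNs : (N : ℝ) * s ≤ r := by
    have := Nat.floor_le (a := r / s) (by positivity)
    rwa [le_div_iff₀ hs] at this
  have hN1 : r / s ≤ N + 1 := (Nat.lt_floor_add_one _).le
  have hsub : (⋃ j ∈ Finset.range (N + 1), T j) ⊆ Metric.ball 0 (2 * r) := by
    intro x hx
    simp only [Set.mem_iUnion, Finset.mem_range] at hx
    obtain ⟨j, hj, hx⟩ := hx
    have h1 := hCr hx.1
    rw [mem_ball_zero_iff] at h1 ⊢
    have h2 : ‖(j : ℝ) • u‖ ≤ r := by
      rw [norm_smul, Real.norm_natCast]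
      have : (j : ℝ) ≤ N := by exact_mod_cast Nat.lt_succ_iff.mp hj
      calc (j : ℝ) * ‖u‖ ≤ N * s := by gcongr
        _ ≤ r := hNs
    have : x = (x + (j : ℝ) • (-u)) + (j : ℝ) • u := by module
    calc ‖x‖ = ‖(x + (j : ℝ) • (-u)) + (j : ℝ) • u‖ := by rw [← this]
      _ ≤ _ := norm_add_le _ _
      _ < 2 * r := by linarith
  have hvol : ((N + 1 : ℕ) : ENNReal) * volume A ≤
      volume (Metric.ball (0 : EuclideanSpace ℝ (Fin k)) (2 * r)) := by
    calc ((N + 1 : ℕ) : ENNReal) * volume A = ∑ j ∈ Finset.range (N + 1), volume (T j) := by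
          simp [hTv]
      _ = volume (⋃ j ∈ Finset.range (N + 1), T j) := by
          rw [measure_biUnion_finset (fun i _ j _ hij => hdisj hij) (fun j _ => hTm j)]
      _ ≤ _ := measure_mono hsub
  have hvol' := ENNReal.toReal_mono measure_ball_lt_top.ne hvol
  rw [Measure.addHaar_ball_of_pos _ _ (by positivity), ENNReal.toReal_mul, ENNReal.toReal_mul,
    ENNReal.toReal_ofReal (by positivity), finrank_euclideanSpace_fin, ENNReal.toReal_natCast] at hvol'
  change ((N + 1 : ℕ) : ℝ) * volume.real A ≤ (2 * r) ^ k * volume.real (Metric.ball 0 1) at hvol'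
  have h3 : r / s * volume.real A ≤ (2 * r) ^ k *
      volume.real (Metric.ball (0 : EuclideanSpace ℝ (Fin k)) 1) := by
    refine le_trans ?_ hvol'
    push_cast
    gcongr
  calc volume.real A = s / r * (r / s * volume.real A) := by field_simp
    _ ≤ _ := by gcongr

lemma aux_ball {k : ℕ} (hk : 1 ≤ k) (K : Set (EuclideanSpace ℝ (Fin k)))
    (hK : Convex ℝ K) (s : ℝ) (hs : 0 < s) (x : EuclideanSpace ℝ (Fin k))
    (h1 : ∀ i, x + EuclideanSpace.single i s ∈ K)
    (h2 : ∀ i, x + EuclideanSpace.single i (-s) ∈ K) :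
    Metric.ball x (s / k) ⊆ K := by
  intro y hy
  have hk0 : (0 : ℝ) < k := by exact_mod_cast hk
  set v := y - x with hv
  have hvn : ‖v‖ < s / k := by rwa [← dist_eq_norm]
  have h3 : ∀ i, x + EuclideanSpace.single i ((k : ℝ) * v i) ∈ K := by
    intro i
    have hvi : |v i| < s / k := lt_of_le_of_lt (by simpa using PiLp.norm_apply_le v i) hvn
    rw [lt_div_iff₀ hk0] at hvi
    have hb := abs_lt.mp (show |(k : ℝ) * v i| < s by rw [abs_mul, abs_of_pos hk0]; linarith)
    have := hK (h1 i) (h2 i) (a := (s + k * v i) / (2 * s)) (b := (s - k * v i) / (2 * s))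
      (div_nonneg (by linarith [hb.1]) (by linarith)) (div_nonneg (by linarith [hb.2]) (by linarith))
      (by field_simp; ring)
    convert this using 1
    ext j
    by_cases hij : j = i
    · subst hij
      simp
      field_simp
      ring
    · simp [hij]
      field_simp
      ring
  have := hK.sum_mem (t := Finset.univ) (w := fun _ : Fin k => (1 / k : ℝ))
    (z := fun i => x + EuclideanSpace.single i ((k : ℝ) * v i))
    (fun i _ => by positivity) (by simp; field_simp) (fun i _ => h3 i)
  convert this using 1
  ext j
  simp [Finset.sum_add_distrib, mul_add, Finset.sum_apply, hv]
  rw [← Finset.mul_sum]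
  simp only [Pi.single_apply, Finset.sum_ite_eq, Finset.mem_univ, if_true]
  field_simp
  ring

lemma aux_bigball {k : ℕ} (hk : 1 ≤ k) (K : Set (EuclideanSpace ℝ (Fin k)))
    (hKcl : IsClosed K) (hKconv : Convex ℝ K)
    (hkinf : Filter.liminf
        (fun r : ℝ => Real.log ((volume (K ∩ Metric.ball 0 r)).toReal) / Real.log r)
        Filter.atTop = (k : ℝ)) (R : ℝ) (hR : 0 < R) :
    ∃ x, Metric.ball x R ⊆ K := by
  have hk0 : (1 : ℝ) ≤ k := by exact_mod_cast hk
  obtain ⟨a, ha, hak⟩ : ∃ a, (∀ᶠ r : ℝ in atTop,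
      a ≤ Real.log ((volume (K ∩ Metric.ball 0 r)).toReal) / Real.log r) ∧ (k : ℝ) - 1 / 2 < a := by
    rw [Filter.liminf_eq] at hkinf
    have hne : {a | ∀ᶠ r : ℝ in atTop,
      a ≤ Real.log ((volume (K ∩ Metric.ball 0 r)).toReal) / Real.log r}.Nonempty := by
      by_contra h
      rw [Set.not_nonempty_iff_eq_empty] at h
      rw [h, Real.sSup_empty] at hkinf
      linarith
    obtain ⟨a, ha, hb⟩ := exists_lt_of_lt_csSup hne (b := (k : ℝ) - 1 / 2) (by linarith)
    exact ⟨a, ha, hb⟩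
  set s := R * k with hs
  have hs0 : 0 < s := by positivity
  set ω := volume.real (Metric.ball (0 : EuclideanSpace ℝ (Fin k)) 1) with hω
  set M := 2 * k * (s * 2 ^ k * ω) with hM
  have hlim : ∀ᶠ r : ℝ in atTop, M < r ^ (1 / 2 : ℝ) :=
    (tendsto_rpow_atTop (by norm_num)).eventually_gt_atTop M
  obtain ⟨r, hr1, hra, hrM⟩ := ((eventually_gt_atTop (1 : ℝ)).and (ha.and hlim)).exists
  have hr0 : 0 < r := by linarith
  set C := K ∩ Metric.ball 0 r with hC
  have hCm : MeasurableSet C := hKcl.measurableSet.inter measurableSet_ball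
  have hCc : Convex ℝ C := hKconv.inter (convex_ball 0 r)
  have hCfin : volume C ≠ ⊤ :=
    ((measure_mono Set.inter_subset_right).trans_lt measure_ball_lt_top).ne
  change a ≤ Real.log (volume.real C) / Real.log r at hra
  have hlogr : 0 < Real.log r := Real.log_pos hr1
  have hV : r ^ ((k : ℝ) - 1 / 2) ≤ volume.real C := by
    have hVpos : 0 < volume.real C := by
      rcases measureReal_nonneg.eq_or_lt' with h | h
      · rw [h] at hra; simp at hra; linarith
      · exact h
    rw [le_div_iff₀ hlogr] at hra
    rw [← Real.log_le_log_iff (by positivity) hVpos, Real.log_rpow hr0]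
    nlinarith
  have hMV : 2 * k * (s / r * ((2 * r) ^ k * ω)) < volume.real C := by
    refine lt_of_lt_of_le ?_ hV
    have e1 : r ^ ((k : ℝ) - 1 / 2) = r ^ k / r * r ^ (1 / 2 : ℝ) := by
      rw [← Real.rpow_natCast, ← Real.rpow_sub_one hr0.ne', ← Real.rpow_add hr0]
      congr 1; ring
    rw [e1]
    calc 2 * k * (s / r * ((2 * r) ^ k * ω)) = r ^ k / r * M := by rw [hM, mul_pow]; ring
      _ < _ := by gcongr
  let U : Fin k × Bool → EuclideanSpace ℝ (Fin k) :=
    fun q => EuclideanSpace.single q.1 (if q.2 then s else -s)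
  have hU : ∀ q, ‖U q‖ ≤ s := by
    rintro ⟨i, b⟩
    cases b <;> simp [U, abs_of_pos hs0]
  have hex : ∃ x ∈ C, ∀ q, x + U q ∈ C := by
    by_contra! hcon
    have hsub : C ⊆ ⋃ q, {x ∈ C | x + U q ∉ C} := by
      intro x hx
      obtain ⟨q, hq⟩ := hcon x hx
      exact Set.mem_iUnion.mpr ⟨q, hx, hq⟩
    have h1 : volume.real C ≤ ∑ q, volume.real {x ∈ C | x + U q ∉ C} := by
      refine (measureReal_mono hsub ?_).trans (measureReal_iUnion_fintype_le _)
      exact ((measure_mono (Set.iUnion_subset fun q x hx => hx.1)).trans_lt hCfin.lt_top).ne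
    have h2 : ∑ q, volume.real {x ∈ C | x + U q ∉ C} ≤
        ∑ q : Fin k × Bool, s / r * ((2 * r) ^ k * ω) :=
      Finset.sum_le_sum fun q _ => aux_transl C hCc hCm r hr0 Set.inter_subset_right s hs0 _ (hU q)
    simp at h2
    linarith
  obtain ⟨x, _, hx⟩ := hex
  refine ⟨x, ?_⟩
  have := aux_ball hk K hKconv s hs0 x (fun i => by simpa [U] using (hx (i, true)).1)
    (fun i => by simpa [U] using (hx (i, false)).1)
  rwa [hs, mul_div_assoc, div_self (by linarith), mul_one] at this

lemma aux_scale {k : ℕ} (φ : EuclideanSpace ℝ (Fin k) → ℝ) (hφ : Differentiable ℝ φ)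
    (p : ℝ) (x : EuclideanSpace ℝ (Fin k)) (c : ℝ) (hc : 0 < c) :
    (∫ y, ‖gradient (fun y => φ (c • (y - x))) y‖ ^ p) / (∫ y, |φ (c • (y - x))| ^ p) =
      c ^ p * ((∫ y, ‖gradient φ y‖ ^ p) / (∫ y, |φ y| ^ p)) := by
  have hg : ∀ y, ‖gradient (fun y => φ (c • (y - x))) y‖ ^ p =
      c ^ p * ‖gradient φ (c • (y - x))‖ ^ p := by
    intro y
    have h1 : HasFDerivAt (fun y => φ (c • (y - x)))
        ((fderiv ℝ φ (c • (y - x))).comp (c • ContinuousLinearMap.id ℝ _)) y :=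
      ((hφ _).hasFDerivAt).comp y (((hasFDerivAt_id y).sub_const x).const_smul c)
    rw [gradient, gradient, LinearIsometryEquiv.norm_map, LinearIsometryEquiv.norm_map, h1.fderiv,
      ContinuousLinearMap.comp_smul, ContinuousLinearMap.comp_id, norm_smul, Real.norm_of_nonneg hc.le,
      Real.mul_rpow hc.le (norm_nonneg _)]
  simp_rw [hg]
  have hi : ∀ f : EuclideanSpace ℝ (Fin k) → ℝ, ∫ y, f (c • (y - x)) =
      |(c ^ k)⁻¹| * ∫ y, f y := by
    intro f
    rw [integral_sub_right_eq_self (fun y => f (c • y)) x, Measure.integral_comp_smul]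
    simp
  rw [integral_const_mul, hi (fun y => ‖gradient φ y‖ ^ p), hi (fun y => |φ y| ^ p)]
  have : |(c ^ k)⁻¹| ≠ 0 := by positivity
  rw [mul_left_comm, mul_div_mul_left _ _ this, mul_div_assoc]

/-- For a closed convex set `K ⊆ ℝ^k` with nonempty interior and dimension at infinity
equal to `k`, the bottom of the Neumann-type Rayleigh quotient over functions supported
in `K` is zero (Lemma 4.4 of the paper). -/
theorem rayleigh_quotient_inf_zero_of_full_dim_at_infinity
    (k : ℕ) (hk : 1 ≤ k) (K : Set (EuclideanSpace ℝ (Fin k)))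
    (hKcl : IsClosed K) (hKconv : Convex ℝ K) (hKint : (interior K).Nonempty)
    (hkinf : Filter.liminf
        (fun r : ℝ => Real.log ((volume (K ∩ Metric.ball 0 r)).toReal) / Real.log r)
        Filter.atTop = (k : ℝ))
    (p : ℝ) (hp : 1 ≤ p) :
    sInf { r : ℝ | ∃ η : EuclideanSpace ℝ (Fin k) → ℝ,
        ContDiff ℝ (⊤ : ℕ∞) η ∧ HasCompactSupport η ∧ η ≠ 0 ∧ tsupport η ⊆ interior K ∧
        r = (∫ y, ‖gradient η y‖ ^ p) / (∫ y, |η y| ^ p) } = 0 := by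
  set S := { r : ℝ | ∃ η : EuclideanSpace ℝ (Fin k) → ℝ,
        ContDiff ℝ (⊤ : ℕ∞) η ∧ HasCompactSupport η ∧ η ≠ 0 ∧ tsupport η ⊆ interior K ∧
        r = (∫ y, ‖gradient η y‖ ^ p) / (∫ y, |η y| ^ p) } with hS
  have hnn : ∀ r ∈ S, 0 ≤ r := by
    rintro r ⟨η, -, -, -, -, rfl⟩
    exact div_nonneg (integral_nonneg fun y => by positivity) (integral_nonneg fun y => by positivity)
  let φ : ContDiffBump (0 : EuclideanSpace ℝ (Fin k)) := ⟨1, 2, by norm_num, by norm_num⟩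
  set Q := (∫ y, ‖gradient φ y‖ ^ p) / (∫ y, |φ y| ^ p) with hQ
  have hmem : ∀ c : ℝ, 0 < c → c ^ p * Q ∈ S := by
    intro c hc
    obtain ⟨x, hx⟩ := aux_bigball hk K hKcl hKconv hkinf (3 / c) (by positivity)
    have hsupp : tsupport (fun y => φ (c • (y - x))) ⊆ Metric.closedBall x (2 / c) := by
      apply closure_minimal _ Metric.isClosed_closedBall
      intro y hy
      have h1 : c • (y - x) ∈ Function.support φ := hy
      rw [φ.support_eq, mem_ball_zero_iff, norm_smul, Real.norm_of_nonneg hc.le] at h1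
      rw [Metric.mem_closedBall, dist_eq_norm, le_div_iff₀ hc]
      change c * ‖y - x‖ < 2 at h1
      linarith
    refine ⟨fun y => φ (c • (y - x)), ?_, ?_, ?_, ?_, ?_⟩
    · exact φ.contDiff.comp ((contDiff_id.sub contDiff_const).const_smul c)
    · exact HasCompactSupport.of_support_subset_isCompact (isCompact_closedBall x (2 / c))
        ((subset_tsupport _).trans hsupp)
    · intro h
      have := congrFun h x
      simp at this
      have h1 := φ.eventuallyEq_one.eq_of_nhds
      simp [this] at h1
    · have h2 : Metric.ball x (3 / c) ⊆ interior K := interior_maximal hx Metric.isOpen_ball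
      refine hsupp.trans ((Metric.closedBall_subset_ball ?_).trans h2)
      gcongr
      norm_num
    · rw [aux_scale φ (φ.contDiff (n := 1)|>.differentiable (by norm_num)) p x c hc]
  apply le_antisymm
  · have hlim : Tendsto (fun c : ℝ => c ^ p * Q) (nhdsWithin 0 (Ioi 0)) (nhds 0) := by
      have h : Tendsto (fun c : ℝ => c ^ p * Q) (nhds 0) (nhds ((0 : ℝ) ^ p * Q)) :=
        ((Real.continuous_rpow_const (by linarith)).mul continuous_const).tendsto 0
      rw [Real.zero_rpow (by linarith), zero_mul] at h
      exact h.mono_left nhdsWithin_le_nhds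
    refine ge_of_tendsto hlim ?_
    filter_upwards [self_mem_nhdsWithin] with c hc
    exact csInf_le ⟨0, hnn⟩ (hmem c hc)
  · exact Real.sInf_nonneg hnn
end
end
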